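/- arXiv:1508.02962 — 2 statements merged into one kernel-verified Lean document; each statement's English description precedes it below -/
import Mathlib

section
/- Let F be a cone subequation on ℝⁿ with dual F̃, and let h be a downward-pointing singular F-harmonic of polar type at a point x₀ ∈ ℝⁿ. Suppose v is F-subharmonic and w is F̃-subharmonic on a deleted neighborhood of x₀, and that there exist constants c and k with v ≤ h + c and w ≤ −h + k near x₀. Then the function u = v + w, extended to x₀ by u(x₀) = limsup_{x→x₀} (v(x) + w(x)), is subaffine on a neighborhood of x₀. -/
open scoped Topology Classical
open Filter

noncomputable section

/-- Euclidean space ℝⁿ. -/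
abbrev EucSp (n : ℕ) := EuclideanSpace ℝ (Fin n)

/-- The space Sym²(ℝⁿ) of symmetric real n×n matrices, with its subspace topology. -/
abbrev SymMat (n : ℕ) := selfAdjoint (Matrix (Fin n) (Fin n) ℝ)

variable {n : ℕ}

/-- The matrix of the orthogonal projection onto the line ℝ·e (for a unit vector e). -/
def projMat (e : EucSp n) : Matrix (Fin n) (Fin n) ℝ := Matrix.of fun i j => e i * e j

lemma projMat_selfAdjoint (e : EucSp n) :
    projMat e ∈ selfAdjoint (Matrix (Fin n) (Fin n) ℝ) := by
  rw [selfAdjoint.mem_iff]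
  ext i j
  simp [projMat, Matrix.star_apply, mul_comm]

/-- P_e, the projection onto ℝ·e, as an element of Sym²(ℝⁿ). -/
def symProj (e : EucSp n) : SymMat n := ⟨projMat e, projMat_selfAdjoint e⟩

/-- The matrix P_{e⊥} − (p−1)·P_e. -/
def charMatM (p : ℝ) (e : EucSp n) : Matrix (Fin n) (Fin n) ℝ :=
  (1 - projMat e) - (p - 1) • projMat e

lemma charMatM_selfAdjoint (p : ℝ) (e : EucSp n) :
    charMatM p e ∈ selfAdjoint (Matrix (Fin n) (Fin n) ℝ) := by
  have h := projMat_selfAdjoint e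
  rw [selfAdjoint.mem_iff] at h ⊢
  simp [charMatM, star_sub, star_smul, star_one, h]

/-- P_{e⊥} − (p−1)·P_e as an element of Sym²(ℝⁿ). -/
def charMat (p : ℝ) (e : EucSp n) : SymMat n := ⟨charMatM p e, charMatM_selfAdjoint p e⟩

/-- A (constant coefficient, pure second order) cone subequation on ℝⁿ: a nonempty,
closed, proper subset of Sym²(ℝⁿ) satisfying positivity (F1) and the cone property (F2). -/
structure ConeSubequation (n : ℕ) where
  carrier : Set (SymMat n)
  nonempty' : carrier.Nonempty
  proper' : carrier ≠ Set.univ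
  isClosed' : IsClosed carrier
  f1 : ∀ A ∈ carrier, ∀ P : SymMat n, (P : Matrix (Fin n) (Fin n) ℝ).PosSemidef → A + P ∈ carrier
  f2 : ∀ A ∈ carrier, ∀ t : ℝ, 0 < t → t • A ∈ carrier

/-- The dual of a set of symmetric matrices: F̃ = {A : −A ∉ Int F}. -/
def dualSet (S : Set (SymMat n)) : Set (SymMat n) := {A | -A ∉ interior S}

/-- The subequation P = {A ≥ 0} of positive semidefinite matrices. -/
def PosP (n : ℕ) : Set (SymMat n) := {A | (A : Matrix (Fin n) (Fin n) ℝ).PosSemidef}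

/-- The Hessian matrix (D²f)(x) of a real function on ℝⁿ. -/
def hessMatrix (f : EucSp n → ℝ) (x : EucSp n) : Matrix (Fin n) (Fin n) ℝ :=
  Matrix.of fun i j =>
    iteratedFDeriv ℝ 2 f x ![EuclideanSpace.single i 1, EuclideanSpace.single j 1]

/-- ψ is a test function for u at x₀ (relative to the set X): ψ is C² near x₀,
u ≤ ψ near x₀ (within X), and u(x₀) = ψ(x₀). -/
def IsTestAt (X : Set (EucSp n)) (u : EucSp n → EReal) (ψ : EucSp n → ℝ) (x₀ : EucSp n) :
    Prop :=
  ContDiffAt ℝ 2 ψ x₀ ∧ (∀ᶠ x in 𝓝[X] x₀, u x ≤ (ψ x : EReal)) ∧ u x₀ = (ψ x₀ : EReal)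

/-- u admits no test functions at x₀ (relative to X). -/
def NoTestAt (X : Set (EucSp n)) (u : EucSp n → EReal) (x₀ : EucSp n) : Prop :=
  ∀ ψ : EucSp n → ℝ, ¬ IsTestAt X u ψ x₀

/-- u is S-subharmonic on X (viscosity sense): u is upper semicontinuous on X with values
in [−∞,∞), and for every test function ψ for u at a point of X, the Hessian of ψ there
lies in S. -/
def FSubharmonicOn (S : Set (SymMat n)) (X : Set (EucSp n)) (u : EucSp n → EReal) : Prop :=
  UpperSemicontinuousOn u X ∧ (∀ x ∈ X, u x ≠ ⊤) ∧
    ∀ x₀ ∈ X, ∀ ψ : EucSp n → ℝ, IsTestAt X u ψ x₀ →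
      hessMatrix ψ x₀ ∈ Subtype.val '' S

/-- u is F-harmonic on X: u is F-subharmonic and −u is F̃-subharmonic on X. -/
def FHarmonicOn (F : ConeSubequation n) (X : Set (EucSp n)) (u : EucSp n → EReal) : Prop :=
  FSubharmonicOn F.carrier X u ∧ FSubharmonicOn (dualSet F.carrier) X (fun x => -u x)

/-- u is subaffine on X, i.e. P̃-subharmonic on X. -/
def SubaffineOn (X : Set (EucSp n)) (u : EucSp n → EReal) : Prop :=
  FSubharmonicOn (dualSet (PosP n)) X u

/-- h is a downward-pointing singular F-harmonic at x₀ on the neighborhood U: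
continuous, F-subharmonic on U, F-harmonic on U∖{x₀}, with a strict minimum at x₀, and
either of polar type (h(x₀) = −∞) or of finite type (h(x₀) > −∞, no test functions at x₀). -/
structure DPSingular (F : ConeSubequation n) (U : Set (EucSp n)) (x₀ : EucSp n)
    (h : EucSp n → EReal) : Prop where
  isOpen' : IsOpen U
  mem : x₀ ∈ U
  cont : ContinuousOn h U
  subh : FSubharmonicOn F.carrier U h
  harm : FHarmonicOn F (U \ {x₀}) h
  strictMin : ∀ x ∈ U, x ≠ x₀ → h x₀ < h x
  polarOrFinite : h x₀ = ⊥ ∨ (h x₀ ≠ ⊥ ∧ NoTestAt U h x₀)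

/-- Polar-case asymptotic equivalence H ≈ h at x₀: h − C ≤ H ≤ h + C near x₀. -/
def PolarAsymp (H : EucSp n → ℝ) (h : EucSp n → EReal) (x₀ : EucSp n) : Prop :=
  ∃ C : ℝ, ∀ᶠ x in 𝓝[≠] x₀, h x - (C : EReal) ≤ (H x : EReal) ∧ (H x : EReal) ≤ h x + (C : EReal)

/-- Finite-case asymptotic equivalence H ∼ h at x₀:
lim_{x→x₀} (H(x) − H(x₀))/(h(x) − h(x₀)) = 1. -/
def FiniteAsymp (H : EucSp n → ℝ) (h : EucSp n → EReal) (x₀ : EucSp n) : Prop :=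
  Tendsto (fun x => (H x - H x₀) / ((h x).toReal - (h x₀).toReal)) (𝓝[≠] x₀) (𝓝 1)

/-- Ω is a bounded domain: open, connected and bounded. -/
def IsBoundedDomain (Ω : Set (EucSp n)) : Prop :=
  IsOpen Ω ∧ IsConnected Ω ∧ Bornology.IsBounded Ω

/-- Condition (F3): −P_e ∉ F for every unit vector e. -/
def CondF3 (F : ConeSubequation n) : Prop :=
  ∀ e : EucSp n, ‖e‖ = 1 → -(symProj e) ∉ F.carrier

/-- The inward unit normal −∇ρ(x)/|∇ρ(x)| of the hypersurface {ρ = 0} bounding {ρ < 0}. -/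
def innerNormal (ρ : EucSp n → ℝ) (x : EucSp n) : EucSp n :=
  -(‖gradient ρ x‖⁻¹ • gradient ρ x)

/-- The second fundamental form of {ρ = 0} at x with respect to the inward normal,
extended by zero on the normal line: the tangential part of Hess ρ(x)/|∇ρ(x)|. -/
def secondFF (ρ : EucSp n → ℝ) (x : EucSp n) : Matrix (Fin n) (Fin n) ℝ :=
  ‖gradient ρ x‖⁻¹ •
    ((1 - projMat (innerNormal ρ x)) * hessMatrix ρ x * (1 - projMat (innerNormal ρ x)))

/-- Ω has smooth boundary which is strictly F-convex: Ω is globally defined by a smooth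
defining function ρ with nonvanishing gradient along ∂Ω, and at every boundary point
II_x + t·P_{ν(x)} ∈ Int F for all sufficiently large t. -/
def StrictlyConvexBoundary (F : ConeSubequation n) (Ω : Set (EucSp n)) : Prop :=
  ∃ ρ : EucSp n → ℝ, ContDiff ℝ (⊤ : ℕ∞) ρ ∧ Ω = {x | ρ x < 0} ∧
    ∀ x ∈ frontier Ω, gradient ρ x ≠ 0 ∧
      ∃ t₀ : ℝ, ∀ t ≥ t₀,
        secondFF ρ x + t • projMat (innerNormal ρ x) ∈ Subtype.val '' interior F.carrier

/-- F is invariant under O(n): gᵀ A g ∈ F for every orthogonal g and A ∈ F. -/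
def OrthInvariant (F : ConeSubequation n) : Prop :=
  ∀ g : Matrix (Fin n) (Fin n) ℝ, g.transpose * g = 1 →
    ∀ A ∈ F.carrier, ∀ B : SymMat n,
      (B : Matrix (Fin n) (Fin n) ℝ) = g.transpose * (A : Matrix (Fin n) (Fin n) ℝ) * g →
      B ∈ F.carrier

/-- F has Riesz characteristic p: P_{e⊥} − (p−1)P_e ∈ ∂F for every unit vector e. -/
def HasRieszChar (F : ConeSubequation n) (p : ℝ) : Prop :=
  ∀ e : EucSp n, ‖e‖ = 1 → charMat p e ∈ frontier F.carrier

/-- The Riesz kernel K_p. -/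
def rieszKernel (p : ℝ) (x : EucSp n) : ℝ :=
  if p = 2 then Real.log ‖x‖ else -(p - 2)⁻¹ * ‖x‖ ^ (2 - p)

section SemiconvexFunctions

variable {E : Type*} [NormedAddCommGroup E] [InnerProductSpace ℝ E]

open scoped RealInnerProductSpace NNReal

/-- A function is semiconvex with constant `C` if adding `C / 2 * ‖x‖ ^ 2` makes it convex. -/
def SemiconvexWith (C : ℝ) (f : E → ℝ) : Prop :=
  ∀ (x y : E) (a b : ℝ), 0 ≤ a → 0 ≤ b → a + b = 1 →
    f (a • x + b • y) ≤ a * f x + b * f y + C / 2 * (a * b * ‖x - y‖ ^ 2)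

lemma norm_sq_convex_combination (x y : E) {a b : ℝ} (hab : a + b = 1) :
    ‖a • x + b • y‖ ^ 2 = a * ‖x‖ ^ 2 + b * ‖y‖ ^ 2 - a * b * ‖x - y‖ ^ 2 := by
  obtain rfl : b = 1 - a := by linarith
  rw [norm_add_sq_real, norm_sub_sq_real, norm_smul, norm_smul, inner_smul_left, inner_smul_right,
    mul_pow, mul_pow, Real.norm_eq_abs, Real.norm_eq_abs, sq_abs, sq_abs]
  simp only [conj_trivial]
  ring

namespace SemiconvexWith

variable {C D : ℝ} {f g : E → ℝ}

lemma add (hf : SemiconvexWith C f) (hg : SemiconvexWith D g) :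
    SemiconvexWith (C + D) (fun x => f x + g x) := fun x y a b ha hb hab => by
  have h1 := hf x y a b ha hb hab
  have h2 := hg x y a b ha hb hab
  simp only
  linarith

lemma mono (hf : SemiconvexWith C f) (hCD : C ≤ D) : SemiconvexWith D f :=
  fun x y a b ha hb hab => by
    have h1 := hf x y a b ha hb hab
    have h2 : 0 ≤ a * b * ‖x - y‖ ^ 2 := by positivity
    nlinarith

lemma convexOn (hf : SemiconvexWith C f) :
    ConvexOn ℝ Set.univ (fun x => f x + C / 2 * ‖x‖ ^ 2) := by
  refine ⟨convex_univ, fun x _ y _ a b ha hb hab => ?_⟩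
  have h1 := hf x y a b ha hb hab
  simp only [norm_sq_convex_combination x y hab, smul_eq_mul]
  linarith

lemma continuous [FiniteDimensional ℝ E] (hf : SemiconvexWith C f) : Continuous f := by
  have h1 : Continuous (fun x => f x + C / 2 * ‖x‖ ^ 2) :=
    continuousOn_univ.1 (hf.convexOn.continuousOn isOpen_univ)
  have h2 : Continuous (fun x : E => C / 2 * ‖x‖ ^ 2) := by fun_prop
  exact (h1.sub h2).congr fun x => by simp

end SemiconvexWith

lemma semiconvexWith_const_mul_norm_sub_sq (κ : ℝ) (x₀ : E) :
    SemiconvexWith (-2 * κ) (fun x => κ * ‖x - x₀‖ ^ 2) := fun x y a b _ _ hab => by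
  have h1 : a • x + b • y - x₀ = a • (x - x₀) + b • (y - x₀) := by
    have : x₀ = (a + b) • x₀ := by rw [hab, one_smul]
    nth_rewrite 1 [this]
    module
  simp only [h1, norm_sq_convex_combination (x - x₀) (y - x₀) hab, sub_sub_sub_cancel_right]
  linarith

/-- The least semiconcave majorant of a semiconvex function is again semiconvex,
with the same constant. -/
lemma SemiconvexWith.exists_least_semiconcave_majorant {C L : ℝ} {f m : E → ℝ}
    (hf : SemiconvexWith C f) (hm : SemiconvexWith L (fun x => -m x)) (hfm : ∀ x, f x ≤ m x) :
    ∃ θ : E → ℝ, (∀ x, f x ≤ θ x) ∧ SemiconvexWith L (fun x => -θ x) ∧ SemiconvexWith C θ ∧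
      ∀ m' : E → ℝ, SemiconvexWith L (fun x => -m' x) → (∀ x, f x ≤ m' x) → ∀ x, θ x ≤ m' x := by
  let S : Set (E → ℝ) := {m' | SemiconvexWith L (fun x => -m' x) ∧ ∀ x, f x ≤ m' x}
  have : Nonempty S := ⟨⟨m, hm, hfm⟩⟩
  let θ : E → ℝ := fun x => ⨅ m' : S, (m' : E → ℝ) x
  have hbdd (x : E) : BddBelow (Set.range fun m' : S => (m' : E → ℝ) x) :=
    ⟨f x, by rintro _ ⟨m', rfl⟩; exact m'.2.2 x⟩
  have hle : ∀ m' : E → ℝ, SemiconvexWith L (fun x => -m' x) → (∀ x, f x ≤ m' x) →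
      ∀ x, θ x ≤ m' x := fun m' h1 h2 x => ciInf_le (hbdd x) (⟨m', h1, h2⟩ : S)
  have hfθ : ∀ x, f x ≤ θ x := fun x => le_ciInf fun m' => m'.2.2 x
  have hθ : SemiconvexWith L (fun x => -θ x) := fun x y a b ha hb hab => by
    have : a * θ x + b * θ y - L / 2 * (a * b * ‖x - y‖ ^ 2) ≤ θ (a • x + b • y) := by
      refine le_ciInf fun m' => ?_
      have h1 := m'.2.1 x y a b ha hb hab
      have h2 := mul_le_mul_of_nonneg_left (hle m' m'.2.1 m'.2.2 x) ha
      have h3 := mul_le_mul_of_nonneg_left (hle m' m'.2.1 m'.2.2 y) hb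
      simp only at h1
      linarith
    simp only
    linarith
  refine ⟨θ, hfθ, hθ, fun x y a b ha hb hab => ?_, hle⟩
  have key := hle (fun z => a * θ (z + b • (x - y)) + b * θ (z - a • (x - y)) +
    C / 2 * (a * b * ‖x - y‖ ^ 2)) ?_ ?_ (a • x + b • y)
  · have e1 : a • x + b • y + b • (x - y) = x := by
      calc _ = (a + b) • x := by module
        _ = x := by rw [hab, one_smul]
    have e2 : a • x + b • y - a • (x - y) = y := by
      calc _ = (a + b) • y := by module
        _ = y := by rw [hab, one_smul]
    simpa only [e1, e2] using key
  · intro z w s t hs ht hst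
    have e1 (v : E) : s • z + t • w + v = s • (z + v) + t • (w + v) := by
      calc _ = s • z + t • w + (s + t) • v := by rw [hst, one_smul]
        _ = _ := by module
    have h1 := hθ (z + b • (x - y)) (w + b • (x - y)) s t hs ht hst
    have h2 := hθ (z + -(a • (x - y))) (w + -(a • (x - y))) s t hs ht hst
    simp only [← e1, add_sub_add_right_eq_sub] at h1 h2
    simp only [← sub_eq_add_neg] at h2
    simp only
    have h3 := mul_le_mul_of_nonneg_left h1 ha
    have h4 := mul_le_mul_of_nonneg_left h2 hb
    have h5 : C / 2 * (a * b * ‖x - y‖ ^ 2) =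
      s * (C / 2 * (a * b * ‖x - y‖ ^ 2)) + t * (C / 2 * (a * b * ‖x - y‖ ^ 2)) := by
      rw [← add_mul, hst, one_mul]
    have h6 : L / 2 * (s * t * ‖z - w‖ ^ 2) =
      a * (L / 2 * (s * t * ‖z - w‖ ^ 2)) + b * (L / 2 * (s * t * ‖z - w‖ ^ 2)) := by
      rw [← add_mul, hab, one_mul]
    linarith
  · intro z
    have e1 : a • (z + b • (x - y)) + b • (z - a • (x - y)) = z := by
      calc _ = (a + b) • z := by module
        _ = z := by rw [hab, one_smul]
    have h1 := hf (z + b • (x - y)) (z - a • (x - y)) a b ha hb hab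
    have e2 : z + b • (x - y) - (z - a • (x - y)) = x - y := by
      calc _ = (a + b) • (x - y) := by module
        _ = _ := by rw [hab, one_smul]
    rw [e1, e2] at h1
    have h2 := mul_le_mul_of_nonneg_left (hfθ (z + b • (x - y))) ha
    have h3 := mul_le_mul_of_nonneg_left (hfθ (z - a • (x - y))) hb
    linarith

/-- A convex function on a finite-dimensional space has a subgradient at every point. -/
lemma ConvexOn.exists_subgradient [FiniteDimensional ℝ E] {f : E → ℝ}
    (hf : ConvexOn ℝ Set.univ f) (x : E) : ∃ p : E, ∀ y, f x + ⟪p, y - x⟫ ≤ f y := by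
  have hc : Continuous f := continuousOn_univ.1 (hf.continuousOn isOpen_univ)
  have hopen : IsOpen {q : E × ℝ | q.1 ∈ Set.univ ∧ f q.1 < q.2} := by
    simp only [Set.mem_univ, true_and]
    exact isOpen_lt (hc.comp continuous_fst) continuous_snd
  obtain ⟨φ, hφ⟩ := geometric_hahn_banach_point_open (x := (x, f x)) hf.convex_strict_epigraph
    hopen (by simp)
  have hdec (z : E) (t : ℝ) : φ (z, t) = φ (z, 0) + t * φ (0, 1) := by
    have : (z, t) = (z, (0 : ℝ)) + t • ((0 : E), (1 : ℝ)) := by simp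
    rw [this, map_add, map_smul, smul_eq_mul]
  have hpos : 0 < φ (0, 1) := by
    have := hφ (x, f x + 1) (by simp)
    rw [hdec x (f x), hdec x (f x + 1)] at this
    linarith
  let l : E →L[ℝ] ℝ := φ.comp (ContinuousLinearMap.inl ℝ E ℝ)
  refine ⟨-((φ (0, 1))⁻¹ • (InnerProductSpace.toDual ℝ E).symm l), fun y => ?_⟩
  have hle : ∀ ε > 0, φ (x, 0) + f x * φ (0, 1) ≤ φ (y, 0) + f y * φ (0, 1) + ε := fun ε hε => by
    have := hφ (y, f y + ε / φ (0, 1)) (by simp; positivity)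
    rw [hdec x, hdec y, add_mul, div_mul_cancel₀ _ hpos.ne'] at this
    linarith
  have hle' := le_of_forall_pos_le_add hle
  rw [inner_neg_left, inner_smul_left, InnerProductSpace.toDual_symm_apply]
  have hl : l (y - x) = φ (y, 0) - φ (x, 0) := by rw [map_sub]; simp [l]
  rw [hl]
  simp only [conj_trivial]
  have h3 : f x - f y ≤ (φ (0, 1))⁻¹ * (φ (y, 0) - φ (x, 0)) := by
    rw [inv_mul_eq_div, le_div_iff₀ hpos]
    linarith
  linarith

lemma SemiconvexWith.exists_subgradient [FiniteDimensional ℝ E] {C : ℝ} {f : E → ℝ}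
    (hf : SemiconvexWith C f) (x : E) :
    ∃ p : E, ∀ y, f x + ⟪p, y - x⟫ - C / 2 * ‖y - x‖ ^ 2 ≤ f y := by
  obtain ⟨p, hp⟩ := hf.convexOn.exists_subgradient x
  refine ⟨p - C • x, fun y => ?_⟩
  have h1 := hp y
  have h2 : ‖y‖ ^ 2 = ‖x‖ ^ 2 + 2 * ⟪x, y - x⟫ + ‖y - x‖ ^ 2 := by
    rw [← norm_add_sq_real, add_sub_cancel]
  rw [inner_sub_left, inner_smul_left]
  simp only [conj_trivial]
  rw [h2] at h1
  linarith

lemma eq_of_inner_le_mul_norm_sq {p q : E} {K : ℝ} (hK : ∀ h : E, ⟪p - q, h⟫ ≤ K * ‖h‖ ^ 2) :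
    p = q := by
  rw [← sub_eq_zero, ← norm_eq_zero]
  by_contra hne
  have hpos : 0 < ‖p - q‖ ^ 2 := by positivity
  have h1 := hK ((2 * (|K| + 1))⁻¹ • (p - q))
  rw [inner_smul_right, real_inner_self_eq_norm_sq, norm_smul, mul_pow, Real.norm_eq_abs, sq_abs]
    at h1
  have h3 : 0 < |K| + 1 := by positivity
  set s := (2 * (|K| + 1))⁻¹ with hs
  have h4 : 0 < s := by positivity
  have h5 : s * (|K| + 1) = 1 / 2 := by rw [hs]; field_simp
  have h6 : s * ‖p - q‖ ^ 2 ≤ s * ‖p - q‖ ^ 2 * (K * s) := by linarith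
  have h7 : 1 ≤ K * s := by
    by_contra! h
    nlinarith [mul_pos h4 hpos]
  nlinarith [le_abs_self K]

/-- A function which is semiconvex and semiconcave has a Lipschitz gradient. -/
lemma SemiconvexWith.exists_lipschitz_gradient [FiniteDimensional ℝ E] {C L : ℝ} {u : E → ℝ}
    (hC : SemiconvexWith C u) (hL : SemiconvexWith L (fun x => -u x)) :
    ∃ (K : ℝ≥0) (T : E → E), LipschitzWith K T ∧
      (∀ x y, u y ≤ u x + ⟪T x, y - x⟫ + L / 2 * ‖y - x‖ ^ 2) ∧
      ∀ x, HasFDerivAt u (innerSL ℝ (T x)) x := by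
  choose T hT using hC.exists_subgradient
  have hup : ∀ x y, u y ≤ u x + ⟪T x, y - x⟫ + L / 2 * ‖y - x‖ ^ 2 := fun x y => by
    obtain ⟨q, hq⟩ := hL.exists_subgradient x
    have hqT : T x = -q := by
      refine eq_of_inner_le_mul_norm_sq (K := C / 2 + L / 2) fun h => ?_
      have h1 := hT x (x + h)
      have h2 := hq (x + h)
      rw [add_sub_cancel_left] at h1 h2
      rw [sub_neg_eq_add, inner_add_left]
      linarith
    have h2 := hq y
    rw [hqT, inner_neg_left]
    linarith
  set M : ℝ := |C| + |L| + 1 with hM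
  have hM0 : 0 < M := by positivity
  have hCM : ∀ h : E, C / 2 * ‖h‖ ^ 2 ≤ M / 2 * ‖h‖ ^ 2 := fun h => by
    gcongr
    linarith [le_abs_self C, abs_nonneg L]
  have hLM : ∀ h : E, L / 2 * ‖h‖ ^ 2 ≤ M / 2 * ‖h‖ ^ 2 := fun h => by
    gcongr
    linarith [le_abs_self L, abs_nonneg C]
  refine ⟨⟨3 * M, by positivity⟩, T, LipschitzWith.of_dist_le_mul fun x y => ?_, hup, fun x => ?_⟩
  · rw [dist_eq_norm, dist_eq_norm]
    change _ ≤ 3 * M * ‖x - y‖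
    set s : ℝ := (3 * M)⁻¹ with hs
    set D := T x - T y with hD
    have h1 := hT x (y + s • D)
    have h2 := hup y (y + s • D)
    have h3 := hup x y
    have h4 := hCM (y + s • D - x)
    have h5 := hLM (y + s • D - y)
    have h6 := hLM (y - x)
    have e1 : y + s • D - x = (y - x) + s • D := by abel
    have e2 : y + s • D - y = s • D := by abel
    rw [e1] at h1 h4
    rw [e2] at h2 h5
    have h7 : ‖(y - x) + s • D‖ ^ 2 ≤ 2 * (‖y - x‖ ^ 2 + ‖s • D‖ ^ 2) := by
      nlinarith [parallelogram_law_with_norm ℝ (y - x) (s • D), norm_nonneg ((y - x) - s • D)]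
    have h8 : ‖s • D‖ ^ 2 = s ^ 2 * ‖D‖ ^ 2 := by
      rw [norm_smul, mul_pow, Real.norm_eq_abs, sq_abs]
    have h9 : ⟪T x, s • D⟫ - ⟪T y, s • D⟫ = s * ‖D‖ ^ 2 := by
      rw [← inner_sub_left, ← hD, inner_smul_right, real_inner_self_eq_norm_sq]
    rw [inner_add_right] at h1
    rw [norm_sub_rev x y]
    have h10 : s * ‖D‖ ^ 2 ≤ 3 * M / 2 * (‖y - x‖ ^ 2 + s ^ 2 * ‖D‖ ^ 2) := by
      rw [h8] at h5 h7 h2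
      have h11 := mul_le_mul_of_nonneg_left h7 (by positivity : 0 ≤ M / 2)
      linarith
    have hs0 : s * (3 * M) = 1 := by rw [hs]; field_simp
    have h12 : ‖D‖ ^ 2 ≤ (3 * M * ‖y - x‖) ^ 2 := by
      have h13 := mul_le_mul_of_nonneg_left h10 (by positivity : 0 ≤ 3 * M)
      have h14 : 3 * M * (s * ‖D‖ ^ 2) = ‖D‖ ^ 2 := by rw [← mul_assoc, mul_comm (3 * M), hs0, one_mul]
      have h15 : 3 * M * (3 * M / 2 * (‖y - x‖ ^ 2 + s ^ 2 * ‖D‖ ^ 2)) =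
          (3 * M) ^ 2 / 2 * ‖y - x‖ ^ 2 + (s * (3 * M)) ^ 2 / 2 * ‖D‖ ^ 2 := by ring
      rw [h14, h15, hs0] at h13
      linarith
    exact abs_le_of_sq_le_sq' h12 (by positivity) |>.2
  · rw [hasFDerivAt_iff_isLittleO]
    have : (fun y => u y - u x - innerSL ℝ (T x) (y - x)) =O[𝓝 x] fun y => ‖y - x‖ ^ 2 := by
      refine Asymptotics.IsBigO.of_bound (M / 2) (Eventually.of_forall fun y => ?_)
      rw [Real.norm_eq_abs, norm_pow, norm_norm, innerSL_apply_apply, abs_le]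
      constructor <;> linarith [hT x y, hup x y, hCM (y - x), hLM (y - x)]
    exact this.trans_isLittleO (Asymptotics.isLittleO_pow_sub_sub x one_lt_two)

/-- Second order Taylor expansion at a point where the derivative is differentiable. -/
lemma eventually_abs_taylor_two_le {F : Type*} [NormedAddCommGroup F] [NormedSpace ℝ F]
    {u : F → ℝ} {u' : F → F →L[ℝ] ℝ} {A : F →L[ℝ] F →L[ℝ] ℝ} {x : F}
    (hu : ∀ᶠ y in 𝓝 x, HasFDerivAt u (u' y) y) (hu' : HasFDerivAt u' A x) {η : ℝ} (hη : 0 < η) :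
    ∀ᶠ y in 𝓝 x,
      |u y - u x - u' x (y - x) - 1 / 2 * A (y - x) (y - x)| ≤ η * ‖y - x‖ ^ 2 := by
  have h1 := (hasFDerivAt_iff_isLittleO.1 hu').bound hη
  obtain ⟨r, hr, hball⟩ := Metric.eventually_nhds_iff_ball.1 (hu.and h1)
  filter_upwards [Metric.ball_mem_nhds x hr] with y hy
  set h := y - x with hh
  have hmem : ∀ t ∈ Set.Icc (0 : ℝ) 1, x + t • h ∈ Metric.ball x r := fun t ht => by
    rw [mem_ball_iff_norm, add_sub_cancel_left, norm_smul, Real.norm_eq_abs, abs_of_nonneg ht.1]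
    rw [mem_ball_iff_norm] at hy
    exact (mul_le_of_le_one_left (norm_nonneg _) ht.2).trans_lt hy
  have hderiv : ∀ t ∈ Set.Icc (0 : ℝ) 1, HasDerivWithinAt
      (fun t : ℝ => u (x + t • h) - t * u' x h - t ^ 2 / 2 * A h h)
      (u' (x + t • h) h - u' x h - t * A h h) (Set.Icc 0 1) t := fun t ht => by
    have h2 : HasDerivAt (fun t : ℝ => x + t • h) h t := by
      simpa using ((hasDerivAt_id t).smul_const h).const_add x
    have h3 : HasDerivAt (fun t : ℝ => u (x + t • h)) (u' (x + t • h) h) t :=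
      (hball _ (hmem t ht)).1.comp_hasDerivAt t h2
    have h4 : HasDerivAt (fun t : ℝ => t * u' x h) (u' x h) t := by
      simpa using (hasDerivAt_id t).mul_const (u' x h)
    have h5 : HasDerivAt (fun t : ℝ => t ^ 2 / 2 * A h h) (t * A h h) t := by
      have := ((hasDerivAt_pow 2 t).div_const 2).mul_const (A h h)
      refine this.congr_deriv ?_
      norm_num
    exact ((h3.sub h4).sub h5).hasDerivWithinAt
  have key := norm_image_sub_le_of_norm_deriv_le_segment_01' (C := η * ‖h‖ ^ 2) hderiv
    fun t ht => ?_
  · simp only [one_smul, zero_smul, add_zero, hh, add_sub_cancel] at key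
    rw [Real.norm_eq_abs] at key
    convert key using 2
    rw [hh]
    ring
  · have h6 := (hball _ (hmem t ⟨ht.1, ht.2.le⟩)).2
    rw [add_sub_cancel_left, map_smul, norm_smul, Real.norm_eq_abs, abs_of_nonneg ht.1] at h6
    have h7 := (u' (x + t • h) - u' x - t • A h).le_opNorm h
    simp only [sub_apply, smul_apply, smul_eq_mul] at h7
    refine h7.trans ?_
    calc _ ≤ η * (t * ‖h‖) * ‖h‖ := by gcongr
      _ = t * (η * ‖h‖ ^ 2) := by ring
      _ ≤ 1 * (η * ‖h‖ ^ 2) := by gcongr; exact ht.2.le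
      _ = _ := one_mul _

open MeasureTheory Measure in
/-- Lipschitz self-maps of a finite-dimensional space send null sets to null sets. -/
lemma LipschitzWith.addHaar_image_eq_zero {F : Type*} [NormedAddCommGroup F] [NormedSpace ℝ F]
    [FiniteDimensional ℝ F] [MeasurableSpace F] [BorelSpace F] {μ : Measure F} [IsAddHaarMeasure μ]
    {K : ℝ≥0} {T : F → F} (hT : LipschitzWith K T) {s : Set F} (hs : μ s = 0) : μ (T '' s) = 0 := by
  have h1 : μH[Module.finrank ℝ F] s = 0 :=
    absolutelyContinuous_isAddHaarMeasure (μH[Module.finrank ℝ F]) μ hs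
  have h2 : μH[Module.finrank ℝ F] (T '' s) = 0 := by
    have := hT.hausdorffMeasure_image_le (Nat.cast_nonneg (Module.finrank ℝ F)) s
    rw [h1, mul_zero] at this
    exact le_antisymm this zero_le
  exact absolutelyContinuous_isAddHaarMeasure μ (μH[Module.finrank ℝ F]) h2

/-- A Lipschitz gradient has a second order expansion at each point of differentiability. -/
lemma eventually_abs_taylor_two_le_of_gradient {u : E → ℝ} {T : E → E} {A : E →L[ℝ] E} {x : E}
    (hu : ∀ y, HasFDerivAt u (innerSL ℝ (T y)) y) (hT : HasFDerivAt T A x) {η : ℝ} (hη : 0 < η) :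
    ∀ᶠ y in 𝓝 x,
      |u y - u x - ⟪T x, y - x⟫ - 1 / 2 * ⟪A (y - x), y - x⟫| ≤ η * ‖y - x‖ ^ 2 := by
  have h1 : HasFDerivAt (fun y => innerSL ℝ (T y)) ((innerSL ℝ).comp A) x :=
    (innerSL ℝ : E →L[ℝ] E →L[ℝ] ℝ).hasFDerivAt.comp x hT
  simpa [-map_sub] using eventually_abs_taylor_two_le (Eventually.of_forall hu) h1 hη

lemma le_of_eventually_quadratic_le {A : E →L[ℝ] E} {x : E} {c : ℝ}
    (hA : ∀ᶠ y in 𝓝 x, ⟪A (y - x), y - x⟫ ≤ c * ‖y - x‖ ^ 2) (h : E) :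
    ⟪A h, h⟫ ≤ c * ‖h‖ ^ 2 := by
  have h1 : Tendsto (fun t : ℝ => x + t • h) (𝓝[>] 0) (𝓝 x) := by
    have : Continuous (fun t : ℝ => x + t • h) := by fun_prop
    have := this.tendsto 0
    rw [zero_smul, add_zero] at this
    exact this.mono_left nhdsWithin_le_nhds
  obtain ⟨t, ht, ht0⟩ := ((h1.eventually hA).and self_mem_nhdsWithin).exists
  have ht0' : 0 < t := ht0
  rw [add_sub_cancel_left, map_smul, inner_smul_left, inner_smul_right, norm_smul, mul_pow,
    Real.norm_eq_abs, sq_abs] at ht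
  simp only [conj_trivial] at ht
  have h2 : 0 < t ^ 2 := by positivity
  have h3 : t ^ 2 * ⟪A h, h⟫ ≤ t ^ 2 * (c * ‖h‖ ^ 2) := by linarith
  exact le_of_mul_le_mul_left h3 h2

/-- A version of the lemmas of Jensen and Alexandrov for a sum of two semiconvex functions:
if every linear perturbation with slope near `p₀` of `f + g + κ ‖· - x₀‖ ^ 2` attains its maximum,
then at some such maximum point `f` and `g` have second order upper expansions,
whose quadratic parts add up to something at most `-2 * κ`, up to an arbitrarily small error. -/
lemma SemiconvexWith.exists_second_order_expansions [FiniteDimensional ℝ E] {C : ℝ} {f g : E → ℝ}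
    (hf : SemiconvexWith C f) (hg : SemiconvexWith C g) {κ : ℝ} (hκ : 0 ≤ κ) (x₀ p₀ : E) {δ : ℝ}
    (hδ : 0 < δ)
    (hmax : ∀ p, ‖p - p₀‖ < δ → ∃ z, ∀ y, f y + g y + κ * ‖y - x₀‖ ^ 2 - ⟪p, y⟫ ≤
      f z + g z + κ * ‖z - x₀‖ ^ 2 - ⟪p, z⟫) {η : ℝ} (hη : 0 < η) :
    ∃ z p, ‖p - p₀‖ < δ ∧ (∀ y, f y + g y + κ * ‖y - x₀‖ ^ 2 - ⟪p, y⟫ ≤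
      f z + g z + κ * ‖z - x₀‖ ^ 2 - ⟪p, z⟫) ∧ ∃ (a b : E) (A B : E →L[ℝ] E),
      (∀ᶠ y in 𝓝 z, f y ≤ f z + ⟪a, y - z⟫ + 1 / 2 * ⟪A (y - z), y - z⟫ + η * ‖y - z‖ ^ 2) ∧
      (∀ᶠ y in 𝓝 z, g y ≤ g z + ⟪b, y - z⟫ + 1 / 2 * ⟪B (y - z), y - z⟫ + η * ‖y - z‖ ^ 2) ∧
      ∀ h, ⟪A h, h⟫ + ⟪B h, h⟫ ≤ -(2 * κ) * ‖h‖ ^ 2 + η * ‖h‖ ^ 2 := by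
  let _ : MeasurableSpace E := borel E
  have : BorelSpace E := ⟨rfl⟩
  set q : E → ℝ := fun y => κ * ‖y - x₀‖ ^ 2 with hq
  have hqc : SemiconvexWith 0 q :=
    (semiconvexWith_const_mul_norm_sub_sq κ x₀).mono (by linarith)
  have hG : SemiconvexWith (C + C + 0) (fun y => f y + g y + q y) := (hf.add hg).add hqc
  obtain ⟨z₀, hz₀⟩ := hmax p₀ (by simpa using hδ)
  have haff : ∀ (c : ℝ) (p z : E), SemiconvexWith 0 (fun y => -(c + ⟪p, y - z⟫)) :=
    fun c p z x y a b _ _ hab => by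
      have : a • x + b • y - z = a • (x - z) + b • (y - z) := by
        calc _ = a • x + b • y - (a + b) • z := by rw [hab, one_smul]
          _ = _ := by module
      obtain rfl : b = 1 - a := by linarith
      simp only [this, inner_add_right, inner_smul_right]
      linarith
  obtain ⟨Γ, hGΓ, hΓ0, hΓC, hΓmin⟩ := hG.exists_least_semiconcave_majorant
    (haff (f z₀ + g z₀ + q z₀) p₀ z₀) fun y => by
      have := hz₀ y
      rw [inner_sub_right]
      simp only [hq]
      linarith
  obtain ⟨KΓ, TΓ, hTΓ, hΓup, hΓd⟩ := hΓC.exists_lipschitz_gradient hΓ0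
  have hm : SemiconvexWith C (fun y => -(Γ y - q y - g y)) := by
    have := (hΓ0.add hqc).add hg
    rw [add_zero, zero_add] at this
    convert this using 2
    ring
  obtain ⟨θ, hfθ, hθ0, hθC, hθmin⟩ := hf.exists_least_semiconcave_majorant hm fun y => by
    linarith [hGΓ y]
  obtain ⟨Kθ, Tθ, hTθ, hθup, hθd⟩ := hθC.exists_lipschitz_gradient hθ0
  have hθm : ∀ y, θ y ≤ Γ y - q y - g y := hθmin _ hm fun y => by linarith [hGΓ y]
  let μ : MeasureTheory.Measure E := MeasureTheory.Measure.addHaar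
  have hae : ∀ᵐ z ∂μ, DifferentiableAt ℝ TΓ z ∧ DifferentiableAt ℝ Tθ z :=
    hTΓ.ae_differentiableAt.and hTθ.ae_differentiableAt
  obtain ⟨z, hzδ, hzG, hzΓ, hzθ⟩ : ∃ z, ‖TΓ z - p₀‖ < δ ∧ f z + g z + q z = Γ z ∧
      DifferentiableAt ℝ TΓ z ∧ DifferentiableAt ℝ Tθ z := by
    by_contra! hcon
    have hsub : Metric.ball p₀ δ ⊆
        TΓ '' {z | ¬ (DifferentiableAt ℝ TΓ z ∧ DifferentiableAt ℝ Tθ z)} := fun p hp => by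
      rw [mem_ball_iff_norm] at hp
      obtain ⟨z, hz⟩ := hmax p hp
      have hle : ∀ y, Γ y ≤ f z + g z + q z + ⟪p, y - z⟫ :=
        hΓmin _ (haff _ p z) fun y => by
          have := hz y
          rw [inner_sub_right]
          simp only [hq]
          linarith
      have heq : f z + g z + q z = Γ z :=
        le_antisymm (hGΓ z) (by simpa using hle z)
      have hTp : TΓ z = p := by
        obtain ⟨r, hr⟩ := hΓC.exists_subgradient z
        have h1 : r = p := eq_of_inner_le_mul_norm_sq (K := (C + C + 0) / 2) fun h => by
          have h1 := hr (z + h)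
          have h2 := hle (z + h)
          rw [add_sub_cancel_left] at h1 h2
          rw [inner_sub_left]
          linarith
        have h2 : r = TΓ z := eq_of_inner_le_mul_norm_sq (K := (C + C + 0) / 2) fun h => by
          have h1 := hr (z + h)
          have h2 := hΓup z (z + h)
          rw [add_sub_cancel_left] at h1 h2
          rw [inner_sub_left]
          linarith
        rw [← h2, h1]
      refine ⟨z, fun hd => hcon z (by rwa [hTp]) heq hd.1 hd.2, hTp⟩
    have h0 : μ (TΓ '' {z | ¬ (DifferentiableAt ℝ TΓ z ∧ DifferentiableAt ℝ Tθ z)}) = 0 :=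
      hTΓ.addHaar_image_eq_zero (MeasureTheory.ae_iff.1 hae)
    exact (Metric.measure_ball_pos μ p₀ hδ).ne' (MeasureTheory.measure_mono_null hsub h0)
  have hθz : θ z = f z := le_antisymm (by linarith [hθm z]) (hfθ z)
  have htΓ := eventually_abs_taylor_two_le_of_gradient hΓd hzΓ.hasFDerivAt
    (by positivity : 0 < η / 4)
  have htθ := eventually_abs_taylor_two_le_of_gradient hθd hzθ.hasFDerivAt
    (by positivity : 0 < η / 4)
  have hqz : ∀ y, q y = q z + ⟪(2 * κ) • (z - x₀), y - z⟫ + κ * ‖y - z‖ ^ 2 := fun y => by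
    have : y - x₀ = (z - x₀) + (y - z) := by abel
    simp only [hq]
    rw [this, norm_add_sq_real, inner_smul_left]
    simp only [conj_trivial]
    ring
  refine ⟨z, TΓ z, hzδ, fun y => ?_, Tθ z, TΓ z - (2 * κ) • (z - x₀) - Tθ z, fderiv ℝ Tθ z,
    fderiv ℝ TΓ z - (2 * κ) • ContinuousLinearMap.id ℝ E - fderiv ℝ Tθ z, ?_, ?_, fun h => ?_⟩
  · have h1 := hΓup z y
    have h2 := hGΓ y
    rw [inner_sub_right] at h1
    simp only [hq] at h1 h2 hzG
    linarith
  · filter_upwards [htθ] with y hy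
    have h1 := (abs_le.1 hy).2
    have h2 := hfθ y
    have h3 : 0 ≤ η * ‖y - z‖ ^ 2 := by positivity
    rw [hθz] at h1
    linarith
  · filter_upwards [htθ, htΓ] with y hy hy'
    have h1 := (abs_le.1 hy).1
    have h2 := (abs_le.1 hy').2
    have h3 : 0 ≤ η * ‖y - z‖ ^ 2 := by positivity
    have h4 := hθm y
    have h5 := hqz y
    rw [hθz] at h1
    simp only [sub_apply, smul_apply, ContinuousLinearMap.id_apply, inner_sub_left]
    simp only [inner_smul_left, conj_trivial, real_inner_self_eq_norm_sq] at h5 ⊢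
    linarith
  · have h1 : ⟪fderiv ℝ TΓ z h, h⟫ ≤ η / 2 * ‖h‖ ^ 2 := by
      refine le_of_eventually_quadratic_le (x := z) ?_ h
      filter_upwards [htΓ] with y hy
      have h1 := (abs_le.1 hy).1
      have h2 := hΓup z y
      linarith
    have h2 : 0 ≤ η * ‖h‖ ^ 2 := by positivity
    simp only [sub_apply, smul_apply, ContinuousLinearMap.id_apply, inner_sub_left]
    rw [inner_smul_left _ h, real_inner_self_eq_norm_sq]
    simp only [conj_trivial]
    linarith

end SemiconvexFunctions

section SupConvolution

variable {E : Type*} [NormedAddCommGroup E] [InnerProductSpace ℝ E]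

open scoped RealInnerProductSpace

lemma EReal.exists_real_gt_of_add_lt {a b : EReal} {c : ℝ} (ha : a ≠ ⊤) (hb : b ≠ ⊤)
    (h : a + b < (c : EReal)) : ∃ s t : ℝ, a < s ∧ b < t ∧ s + t < c := by
  induction a using EReal.rec with
  | top => exact absurd rfl ha
  | bot =>
    induction b using EReal.rec with
    | top => exact absurd rfl hb
    | bot => exact ⟨0, c - 1, EReal.bot_lt_coe _, EReal.bot_lt_coe _, by linarith⟩
    | coe b => exact ⟨c - b - 2, b + 1, EReal.bot_lt_coe _, by norm_cast; linarith, by linarith⟩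
  | coe a =>
    induction b using EReal.rec with
    | top => exact absurd rfl hb
    | bot => exact ⟨a + 1, c - a - 2, by norm_cast; linarith, EReal.bot_lt_coe _, by linarith⟩
    | coe b =>
      have h' : a + b < c := by exact_mod_cast h
      refine ⟨a + (c - a - b) / 3, b + (c - a - b) / 3, ?_, ?_, by linarith⟩ <;>
        norm_cast <;> linarith

lemma EReal.exists_coe_of_add_eq_coe {a b : EReal} {c : ℝ} (h : a + b = (c : EReal)) :
    ∃ s t : ℝ, a = s ∧ b = t ∧ s + t = c := by
  induction a using EReal.rec with
  | top => induction b using EReal.rec <;> simp at h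
  | bot => simp at h
  | coe a =>
    induction b using EReal.rec with
    | top => simp at h
    | bot => simp at h
    | coe b => exact ⟨a, b, rfl, rfl, by exact_mod_cast h⟩

lemma UpperSemicontinuousOn.exists_real_forall_le {X : Type*} [TopologicalSpace X]
    {v : X → EReal} {K : Set X} (hK : IsCompact K) (hv : UpperSemicontinuousOn v K)
    (htop : ∀ x ∈ K, v x ≠ ⊤) : ∃ M : ℝ, ∀ x ∈ K, v x ≤ M := by
  rcases K.eq_empty_or_nonempty with rfl | hne
  · exact ⟨0, by simp⟩
  obtain ⟨x, hx, hmax⟩ := hv.exists_isMaxOn hne hK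
  exact ⟨(v x).toReal, fun y hy => (hmax hy).trans (EReal.le_coe_toReal (htop x hx))⟩

lemma UpperSemicontinuousOn.add_coe_of_continuous {X : Type*} [TopologicalSpace X]
    {v : X → EReal} {K : Set X} (hv : UpperSemicontinuousOn v K) {q : X → ℝ} (hq : Continuous q) :
    UpperSemicontinuousOn (fun x => v x + (q x : EReal)) K := by
  refine hv.add' ?_ fun x _ => EReal.continuousAt_add ?_ ?_
  · exact (continuous_coe_real_ereal.comp hq).continuousOn.upperSemicontinuousOn
  · exact Or.inr (EReal.coe_ne_bot _)
  · exact Or.inr (EReal.coe_ne_top _)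

/-- The sup-convolution of an upper semicontinuous function on a compact set. -/
lemma UpperSemicontinuousOn.exists_supConvolution {v : E → EReal} {K : Set E} (hK : IsCompact K)
    (hv : UpperSemicontinuousOn v K) (htop : ∀ x ∈ K, v x ≠ ⊤) {x₀ : E} (hx₀ : x₀ ∈ K)
    (hbot : v x₀ ≠ ⊥) (C : ℝ) :
    ∃ (f : E → ℝ) (ξ : E → E), SemiconvexWith C f ∧ (∀ z, ξ z ∈ K) ∧
      (∀ z, v (ξ z) = ((f z + C / 2 * ‖ξ z - z‖ ^ 2 : ℝ) : EReal)) ∧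
      ∀ z, ∀ y ∈ K, v y ≤ ((f z + C / 2 * ‖y - z‖ ^ 2 : ℝ) : EReal) := by
  have key : ∀ z : E, ∃ (s : ℝ) (x : E), x ∈ K ∧
      v x = ((s + C / 2 * ‖x - z‖ ^ 2 : ℝ) : EReal) ∧
      ∀ y ∈ K, v y ≤ ((s + C / 2 * ‖y - z‖ ^ 2 : ℝ) : EReal) := fun z => by
    obtain ⟨x, hx, hmax⟩ := (hv.add_coe_of_continuous
      (q := fun x => -(C / 2 * ‖x - z‖ ^ 2)) (by fun_prop)).exists_isMaxOn ⟨x₀, hx₀⟩ hK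
    have hxb : v x ≠ ⊥ := fun h0 => by
      have := hmax hx₀
      simp only [Set.mem_ofPred_eq, h0, EReal.bot_add, le_bot_iff, EReal.add_eq_bot_iff] at this
      exact this.elim hbot (EReal.coe_ne_bot _)
    lift v x to ℝ using ⟨htop x hx, hxb⟩ with a ha
    refine ⟨a - C / 2 * ‖x - z‖ ^ 2, x, hx, by rw [← ha, sub_add_cancel], fun y hy => ?_⟩
    have h1 := hmax hy
    simp only [Set.mem_ofPred_eq] at h1
    rw [← ha] at h1
    rcases eq_or_ne (v y) ⊥ with h2 | h2
    · rw [h2]; exact bot_le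
    lift v y to ℝ using ⟨htop y hy, h2⟩ with b hb
    norm_cast at h1 ⊢
    linarith
  choose f ξ hξ hfξ hle using key
  refine ⟨f, ξ, fun x y a b ha hb hab => ?_, hξ, hfξ, hle⟩
  set z := a • x + b • y with hz
  have h1 := hle x (ξ z) (hξ z)
  have h2 := hle y (ξ z) (hξ z)
  rw [hfξ z] at h1 h2
  norm_cast at h1 h2
  have h3 := norm_sq_convex_combination (ξ z - x) (ξ z - y) hab
  have h4 : a • (ξ z - x) + b • (ξ z - y) = ξ z - z := by
    calc _ = (a + b) • ξ z - (a • x + b • y) := by module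
      _ = _ := by rw [hab, one_smul]
  rw [h4, sub_sub_sub_cancel_left, norm_sub_rev y x] at h3
  obtain rfl : b = 1 - a := by linarith
  linear_combination mul_le_mul_of_nonneg_left h1 ha + mul_le_mul_of_nonneg_left h2 hb - C / 2 * h3

/-- Near-maximizers of the doubled problem stay away from the boundary of the ball. -/
lemma exists_pos_forall_mem_ball_of_sum_lt [FiniteDimensional ℝ E] {v w : E → EReal} {x₀ p₀ : E}
    {r u₀ κ : ℝ} (hr : 0 < r) (hκ : 0 < κ)
    (hv : UpperSemicontinuousOn v (Metric.closedBall x₀ r))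
    (hw : UpperSemicontinuousOn w (Metric.closedBall x₀ r))
    (hvt : ∀ x ∈ Metric.closedBall x₀ r, v x ≠ ⊤) (hwt : ∀ x ∈ Metric.closedBall x₀ r, w x ≠ ⊤)
    (hvw : ∀ x ∈ Metric.closedBall x₀ r,
      v x + w x ≤ ((u₀ + ⟪p₀, x - x₀⟫ - 2 * κ * ‖x - x₀‖ ^ 2 : ℝ) : EReal)) :
    ∃ α > 0, ∀ x ∈ Metric.closedBall x₀ r, ∀ y ∈ Metric.closedBall x₀ r, ∀ z p : E,
      ‖x - z‖ ≤ α → ‖y - z‖ ≤ α → ‖p - p₀‖ ≤ α → ∀ s t : ℝ, v x = s → w y = t →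
      u₀ ≤ s + t + κ * ‖z - x₀‖ ^ 2 - ⟪p, z - x₀⟫ →
      x ∈ Metric.ball x₀ r ∧ y ∈ Metric.ball x₀ r := by
  by_contra! hcon
  have hpos : ∀ k : ℕ, (0 : ℝ) < 1 / (k + 1) := fun k => Nat.one_div_pos_of_nat
  choose x hx y hy z p hxz hyz hp s t hs ht hu hnot using fun k : ℕ => hcon _ (hpos k)
  have hlim : Tendsto (fun k : ℕ => (1 : ℝ) / (k + 1)) atTop (𝓝 0) :=
    tendsto_one_div_add_atTop_nhds_zero_nat
  obtain ⟨q, hq, φ, hφ, hxq⟩ := (isCompact_closedBall x₀ r).tendsto_subseq hx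
  have hlim' := hlim.comp hφ.tendsto_atTop
  have hxz' : Tendsto (fun k => x (φ k) - z (φ k)) atTop (𝓝 0) :=
    squeeze_zero_norm (fun k => hxz (φ k)) hlim'
  have hyz' : Tendsto (fun k => y (φ k) - z (φ k)) atTop (𝓝 0) :=
    squeeze_zero_norm (fun k => hyz (φ k)) hlim'
  have hp' : Tendsto (fun k => p (φ k)) atTop (𝓝 p₀) :=
    tendsto_sub_nhds_zero_iff.1 (squeeze_zero_norm (fun k => hp (φ k)) hlim')
  have hzq : Tendsto (fun k => z (φ k)) atTop (𝓝 q) := by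
    simpa using hxq.sub hxz'
  have hyq : Tendsto (fun k => y (φ k)) atTop (𝓝 q) := by
    simpa using hyz'.add hzq
  have hqr : r ≤ ‖q - x₀‖ := by
    by_contra! hlt
    have hb : Metric.ball x₀ r ∈ 𝓝 q := Metric.isOpen_ball.mem_nhds (by rwa [mem_ball_iff_norm])
    obtain ⟨k, hk1, hk2⟩ := ((hxq.eventually hb).and (hyq.eventually hb)).exists
    exact hnot _ hk1 hk2
  have hqpos : 0 < ‖q - x₀‖ := hr.trans_le hqr
  have hlt : v q + w q < ((u₀ + ⟪p₀, q - x₀⟫ - κ * ‖q - x₀‖ ^ 2 : ℝ) : EReal) := by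
    refine (hvw q hq).trans_lt ?_
    norm_cast
    nlinarith [mul_pos hκ (pow_pos hqpos 2)]
  obtain ⟨a, b, ha, hb, hab⟩ := EReal.exists_real_gt_of_add_lt (hvt q hq) (hwt q hq) hlt
  have hxq' : Tendsto (fun k => x (φ k)) atTop (𝓝[Metric.closedBall x₀ r] q) :=
    tendsto_nhdsWithin_iff.2 ⟨hxq, Eventually.of_forall fun k => hx _⟩
  have hyq' : Tendsto (fun k => y (φ k)) atTop (𝓝[Metric.closedBall x₀ r] q) :=
    tendsto_nhdsWithin_iff.2 ⟨hyq, Eventually.of_forall fun k => hy _⟩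
  have hcont : Tendsto (fun k => u₀ + ⟪p (φ k), z (φ k) - x₀⟫ - κ * ‖z (φ k) - x₀‖ ^ 2) atTop
      (𝓝 (u₀ + ⟪p₀, q - x₀⟫ - κ * ‖q - x₀‖ ^ 2)) := by
    have h1 : Tendsto (fun k => z (φ k) - x₀) atTop (𝓝 (q - x₀)) := hzq.sub_const x₀
    exact ((hp'.inner h1).const_add u₀).sub ((h1.norm.pow 2).const_mul κ)
  obtain ⟨k, h1, h2, h3⟩ := ((hxq'.eventually (hv q hq _ ha)).and
    ((hyq'.eventually (hw q hq _ hb)).and (hcont.eventually (lt_mem_nhds hab)))).exists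
  rw [hs] at h1
  rw [ht] at h2
  norm_cast at h1 h2
  linarith [hu (φ k)]

/-- A localized theorem on sums: if `v + w` has a strict maximum at `x₀` after subtracting an
affine function, then near `x₀` both summands admit second order upper expansions whose quadratic
parts add up to a negative definite form. -/
lemma exists_upper_expansions_of_strict_max [FiniteDimensional ℝ E] {v w : E → EReal} {x₀ p₀ : E}
    {r u₀ κ η : ℝ} (hr : 0 < r) (hκ : 0 < κ) (hη : 0 < η)
    (hv : UpperSemicontinuousOn v (Metric.closedBall x₀ r))
    (hw : UpperSemicontinuousOn w (Metric.closedBall x₀ r))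
    (hvt : ∀ x ∈ Metric.closedBall x₀ r, v x ≠ ⊤) (hwt : ∀ x ∈ Metric.closedBall x₀ r, w x ≠ ⊤)
    (hu₀ : v x₀ + w x₀ = (u₀ : EReal))
    (hvw : ∀ x ∈ Metric.closedBall x₀ r,
      v x + w x ≤ ((u₀ + ⟪p₀, x - x₀⟫ - 2 * κ * ‖x - x₀‖ ^ 2 : ℝ) : EReal)) :
    ∃ x ∈ Metric.ball x₀ r, ∃ y ∈ Metric.ball x₀ r, ∃ (s t : ℝ) (a b : E) (A B : E →L[ℝ] E),
      v x = s ∧ w y = t ∧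
      (∀ᶠ q in 𝓝 x, v q ≤ ((s + ⟪a, q - x⟫ + 1 / 2 * ⟪A (q - x), q - x⟫ +
        η * ‖q - x‖ ^ 2 : ℝ) : EReal)) ∧
      (∀ᶠ q in 𝓝 y, w q ≤ ((t + ⟪b, q - y⟫ + 1 / 2 * ⟪B (q - y), q - y⟫ +
        η * ‖q - y‖ ^ 2 : ℝ) : EReal)) ∧
      ∀ h, ⟪A h, h⟫ + ⟪B h, h⟫ ≤ -(2 * κ) * ‖h‖ ^ 2 + η * ‖h‖ ^ 2 := by
  have hx₀ : x₀ ∈ Metric.closedBall x₀ r := Metric.mem_closedBall_self hr.le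
  have hK := isCompact_closedBall x₀ r
  obtain ⟨α, hα, hloc⟩ := exists_pos_forall_mem_ball_of_sum_lt hr hκ hv hw hvt hwt hvw
  obtain ⟨v₀, w₀, hv₀, hw₀, hvw₀⟩ := EReal.exists_coe_of_add_eq_coe hu₀
  obtain ⟨M, hM⟩ := hv.exists_real_forall_le hK hvt
  obtain ⟨N, hN⟩ := hw.exists_real_forall_le hK hwt
  set P := ‖p₀‖ + 1 with hP
  have hPpos : 0 < P := by positivity
  set Q := M + N - u₀ + 2 * κ * r ^ 2 + P * (r + 1) with hQ
  set C := 2 * (2 * κ + P + (|Q| + 1) / α ^ 2) with hC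
  have hCα : 0 < (|Q| + 1) / α ^ 2 := by positivity
  have hCpos : 0 < C := by positivity
  obtain ⟨f, ξ, hf, hξ, hfξ, hfle⟩ := hv.exists_supConvolution hK hvt hx₀ (by simp [hv₀]) C
  obtain ⟨g, ζ, hg, hζ, hgζ, hgle⟩ := hw.exists_supConvolution hK hwt hx₀ (by simp [hw₀]) C
  have hfM : ∀ z, f z + C / 2 * ‖ξ z - z‖ ^ 2 ≤ M := fun z => by
    have := hM _ (hξ z)
    rw [hfξ z] at this
    exact_mod_cast this
  have hgN : ∀ z, g z + C / 2 * ‖ζ z - z‖ ^ 2 ≤ N := fun z => by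
    have := hN _ (hζ z)
    rw [hgζ z] at this
    exact_mod_cast this
  have hf0 : v₀ ≤ f x₀ := by
    have := hfle x₀ x₀ hx₀
    rw [hv₀] at this
    norm_cast at this
    simpa using this
  have hg0 : w₀ ≤ g x₀ := by
    have := hgle x₀ x₀ hx₀
    rw [hw₀] at this
    norm_cast at this
    simpa using this
  have hip : ∀ p z : E, ‖p - p₀‖ < min 1 α → -⟪p, z - x₀⟫ ≤ P * ‖z - x₀‖ := fun p z hp => by
    have h1 := abs_real_inner_le_norm p (z - x₀)
    have h2 : ‖p‖ ≤ P := by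
      have : ‖p‖ ≤ ‖p₀‖ + ‖p - p₀‖ := by simpa using norm_add_le p₀ (p - p₀)
      linarith [min_le_left (1 : ℝ) α]
    have h3 := mul_le_mul_of_nonneg_right h2 (norm_nonneg (z - x₀))
    linarith [neg_abs_le ⟪p, z - x₀⟫]
  have hdist : ∀ x ∈ Metric.closedBall x₀ r, ∀ z : E, ‖z - x₀‖ ≤ r + ‖x - z‖ := fun x hx z => by
    rw [mem_closedBall_iff_norm] at hx
    have : ‖z - x₀‖ ≤ ‖x - x₀‖ + ‖z - x‖ := by
      simpa using norm_add_le (x - x₀) (z - x)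
    rw [norm_sub_rev z x] at this
    linarith
  have hest : ∀ p z : E, ‖p - p₀‖ < min 1 α → ∀ d : ℝ, 0 ≤ d → ‖z - x₀‖ ≤ r + d →
      κ * ‖z - x₀‖ ^ 2 - ⟪p, z - x₀⟫ ≤
        (2 * κ + P) * d ^ 2 + (2 * κ * r ^ 2 + P * (r + 1)) := fun p z hp d hd hzd => by
    have h1 := hip p z hp
    have h2 : ‖z - x₀‖ ^ 2 ≤ 2 * r ^ 2 + 2 * d ^ 2 := by
      nlinarith [sq_nonneg (r - d), norm_nonneg (z - x₀)]
    have h3 : ‖z - x₀‖ ≤ r + 1 + d ^ 2 := by nlinarith [sq_nonneg (d - 1)]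
    nlinarith [mul_le_mul_of_nonneg_left h2 hκ.le, mul_le_mul_of_nonneg_left h3 hPpos.le]
  have hCd : ∀ p z : E, ‖p - p₀‖ < min 1 α →
      u₀ ≤ f z + g z + κ * ‖z - x₀‖ ^ 2 - ⟪p, z - x₀⟫ → ‖ξ z - z‖ ≤ α ∧ ‖ζ z - z‖ ≤ α := by
    intro p z hp hz
    have aux : ∀ d : ℝ, 0 ≤ d → ‖z - x₀‖ ≤ r + d → f z + g z + C / 2 * d ^ 2 ≤ M + N → d ≤ α := by
      intro d hd hzd hle
      have h1 := hest p z hp d hd hzd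
      have h2 : (|Q| + 1) / α ^ 2 * d ^ 2 ≤ |Q| + 1 := by
        have h3 : C / 2 = 2 * κ + P + (|Q| + 1) / α ^ 2 := by rw [hC]; ring
        rw [h3] at hle
        linarith [le_abs_self Q]
      rw [div_mul_eq_mul_div, div_le_iff₀ (by positivity)] at h2
      have h4 : d ^ 2 ≤ α ^ 2 := le_of_mul_le_mul_left h2 (by positivity)
      exact (sq_le_sq₀ hd hα.le).1 h4
    have hd1 : 0 ≤ C / 2 * ‖ξ z - z‖ ^ 2 := by positivity
    have hd2 : 0 ≤ C / 2 * ‖ζ z - z‖ ^ 2 := by positivity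
    exact ⟨aux _ (norm_nonneg _) (hdist _ (hξ z) z) (by linarith [hfM z, hgN z]),
      aux _ (norm_nonneg _) (hdist _ (hζ z) z) (by linarith [hfM z, hgN z])⟩
  have hmax : ∀ p, ‖p - p₀‖ < min 1 α → ∃ z, ∀ y, f y + g y + κ * ‖y - x₀‖ ^ 2 - ⟪p, y⟫ ≤
      f z + g z + κ * ‖z - x₀‖ ^ 2 - ⟪p, z⟫ := fun p hp => by
    refine Continuous.exists_forall_ge' (x₀ := x₀) ?_ ?_
    · have := hf.continuous
      have := hg.continuous
      fun_prop
    · have hlarge : ∀ᶠ z in cocompact E, r + α < ‖z - x₀‖ := by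
        have := (isCompact_closedBall x₀ (r + α)).compl_mem_cocompact
        filter_upwards [this] with z hz
        simpa [dist_eq_norm] using hz
      filter_upwards [hlarge] with z hz
      by_contra! hcon
      have h1 := (hCd p z hp ?_).1
      · linarith [hdist _ (hξ z) z]
      · rw [inner_sub_right]
        simp only [sub_self, norm_zero] at hcon
        norm_num at hcon
        linarith
  obtain ⟨z, p, hp, hz, a, b, A, B, hA, hB, hAB⟩ :=
    hf.exists_second_order_expansions hg hκ.le x₀ p₀ (lt_min one_pos hα) hmax hη
  have hzu : u₀ ≤ f z + g z + κ * ‖z - x₀‖ ^ 2 - ⟪p, z - x₀⟫ := by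
    have := hz x₀
    rw [inner_sub_right]
    simp only [sub_self, norm_zero] at this
    norm_num at this
    linarith
  obtain ⟨hd1, hd2⟩ := hCd p z hp hzu
  have hC1 : 0 ≤ C / 2 * ‖ξ z - z‖ ^ 2 := by positivity
  have hC2 : 0 ≤ C / 2 * ‖ζ z - z‖ ^ 2 := by positivity
  obtain ⟨hx, hy⟩ := hloc _ (hξ z) _ (hζ z) z p hd1 hd2 (hp.le.trans (min_le_right _ _)) _ _
    (hfξ z) (hgζ z) (by linarith)
  have htr : ∀ x : E, Tendsto (fun q => z + (q - x)) (𝓝 x) (𝓝 z) := fun x => by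
    have : Continuous fun q => z + (q - x) := by fun_prop
    simpa using this.tendsto x
  refine ⟨ξ z, hx, ζ z, hy, _, _, a, b, A, B, hfξ z, hgζ z, ?_, ?_, hAB⟩
  · filter_upwards [(htr (ξ z)).eventually hA, Metric.isOpen_ball.mem_nhds hx] with q hq hqr
    refine (hfle (z + (q - ξ z)) q (Metric.ball_subset_closedBall hqr)).trans ?_
    rw [add_sub_cancel_left] at hq
    have : q - (z + (q - ξ z)) = ξ z - z := by abel
    rw [this]
    norm_cast
    linarith
  · filter_upwards [(htr (ζ z)).eventually hB, Metric.isOpen_ball.mem_nhds hy] with q hq hqr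
    refine (hgle (z + (q - ζ z)) q (Metric.ball_subset_closedBall hqr)).trans ?_
    rw [add_sub_cancel_left] at hq
    have : q - (z + (q - ζ z)) = ζ z - z := by abel
    rw [this]
    norm_cast
    linarith

end SupConvolution

section QuadraticForms

open scoped RealInnerProductSpace

/-- The quadratic form of a matrix. -/
def matrixQuadForm (M : Matrix (Fin n) (Fin n) ℝ) (x : EucSp n) : ℝ :=
  ∑ i, ∑ j, M i j * x i * x j

lemma matrixQuadForm_add (M N : Matrix (Fin n) (Fin n) ℝ) (x : EucSp n) :
    matrixQuadForm (M + N) x = matrixQuadForm M x + matrixQuadForm N x := by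
  simp only [matrixQuadForm, Matrix.add_apply, ← Finset.sum_add_distrib, add_mul]

lemma matrixQuadForm_smul (c : ℝ) (M : Matrix (Fin n) (Fin n) ℝ) (x : EucSp n) :
    matrixQuadForm (c • M) x = c * matrixQuadForm M x := by
  simp only [matrixQuadForm, Matrix.smul_apply, Finset.mul_sum, smul_eq_mul, mul_assoc]

lemma matrixQuadForm_neg (M : Matrix (Fin n) (Fin n) ℝ) (x : EucSp n) :
    matrixQuadForm (-M) x = -matrixQuadForm M x := by
  simp only [matrixQuadForm, Matrix.neg_apply, ← Finset.sum_neg_distrib, neg_mul]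

lemma matrixQuadForm_one (x : EucSp n) : matrixQuadForm 1 x = ‖x‖ ^ 2 := by
  rw [EuclideanSpace.norm_sq_eq]
  simp [matrixQuadForm, Matrix.one_apply, sq]

lemma abs_matrixQuadForm_le (M : Matrix (Fin n) (Fin n) ℝ) (x : EucSp n) :
    |matrixQuadForm M x| ≤ (∑ i, ∑ j, |M i j|) * ‖x‖ ^ 2 := by
  rw [matrixQuadForm, Finset.sum_mul]
  refine (Finset.abs_sum_le_sum_abs _ _).trans (Finset.sum_le_sum fun i _ => ?_)
  rw [Finset.sum_mul]
  refine (Finset.abs_sum_le_sum_abs _ _).trans (Finset.sum_le_sum fun j _ => ?_)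
  rw [abs_mul, abs_mul, mul_assoc, sq]
  have h : ∀ i, |x i| ≤ ‖x‖ := fun i => by
    simpa using PiLp.norm_apply_le x i
  gcongr
  · exact h i
  · exact h j

lemma dotProduct_mulVec_eq_matrixQuadForm (M : Matrix (Fin n) (Fin n) ℝ) (x : Fin n → ℝ) :
    star x ⬝ᵥ M.mulVec x = matrixQuadForm M (WithLp.toLp 2 x) := by
  simp only [dotProduct, Matrix.mulVec, matrixQuadForm, Finset.mul_sum, star_trivial]
  exact Finset.sum_congr rfl fun i _ => Finset.sum_congr rfl fun j _ => by ring

lemma posSemidef_of_matrixQuadForm_nonneg (A : SymMat n)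
    (hA : ∀ x, 0 ≤ matrixQuadForm (A : Matrix (Fin n) (Fin n) ℝ) x) :
    (A : Matrix (Fin n) (Fin n) ℝ).PosSemidef :=
  .of_dotProduct_mulVec_nonneg A.2 fun x => by
    rw [dotProduct_mulVec_eq_matrixQuadForm]
    exact hA _

lemma Matrix.PosSemidef.matrixQuadForm_nonneg {M : Matrix (Fin n) (Fin n) ℝ} (hM : M.PosSemidef)
    (x : EucSp n) : 0 ≤ matrixQuadForm M x := by
  have := hM.dotProduct_mulVec_nonneg x.ofLp
  rwa [dotProduct_mulVec_eq_matrixQuadForm] at this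

lemma ConeSubequation.mem_interior_of_matrixQuadForm_le (F : ConeSubequation n) {A D : SymMat n}
    (hA : A ∈ F.carrier) {κ : ℝ} (hκ : 0 < κ)
    (hD : ∀ x, matrixQuadForm (A : Matrix (Fin n) (Fin n) ℝ) x + κ * ‖x‖ ^ 2 ≤
      matrixQuadForm (D : Matrix (Fin n) (Fin n) ℝ) x) : D ∈ interior F.carrier := by
  have hcont : Continuous fun G : SymMat n =>
      ∑ i, ∑ j, |(G : Matrix (Fin n) (Fin n) ℝ) i j - (D : Matrix (Fin n) (Fin n) ℝ) i j| := by
    refine continuous_finsetSum _ fun i _ => continuous_finsetSum _ fun j _ => ?_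
    have : Continuous fun G : SymMat n => (G : Matrix (Fin n) (Fin n) ℝ) i j :=
      continuous_subtype_val.matrix_elem i j
    exact (this.sub continuous_const).abs
  rw [mem_interior_iff_mem_nhds]
  filter_upwards [(hcont.tendsto D).eventually (gt_mem_nhds (by simpa using hκ))] with G hG
  have := F.f1 A hA (G - A) (posSemidef_of_matrixQuadForm_nonneg _ fun x => ?_)
  · rwa [add_sub_cancel] at this
  · have h1 := abs_matrixQuadForm_le
      ((G : Matrix (Fin n) (Fin n) ℝ) - (D : Matrix (Fin n) (Fin n) ℝ)) x
    have h2 := hD x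
    have h3 := (mul_le_mul_of_nonneg_right hG.le (sq_nonneg ‖x‖))
    have h4 := (abs_le.1 (h1.trans h3)).1
    rw [AddSubgroupClass.coe_sub]
    rw [sub_eq_add_neg, matrixQuadForm_add, matrixQuadForm_neg] at h4 ⊢
    linarith

lemma exists_matrixQuadForm_le_of_neg_mem_interior {A : SymMat n} (hA : -A ∈ interior (PosP n)) :
    ∃ c > 0, ∀ x, matrixQuadForm (A : Matrix (Fin n) (Fin n) ℝ) x ≤ -c * ‖x‖ ^ 2 := by
  have hcont : Continuous fun c : ℝ => -A - c • (1 : SymMat n) := by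
    have : Continuous fun c : ℝ => -(A : Matrix (Fin n) (Fin n) ℝ) - c • 1 :=
      continuous_const.sub (continuous_id.smul continuous_const)
    exact continuous_induced_rng.2 this
  have h0 : ∀ᶠ c in 𝓝 (0 : ℝ), -A - c • (1 : SymMat n) ∈ PosP n :=
    (hcont.tendsto 0).eventually (by simpa using mem_interior_iff_mem_nhds.1 hA)
  obtain ⟨c, hc, hc0⟩ := ((h0.filter_mono nhdsWithin_le_nhds).and
    (self_mem_nhdsWithin : Set.Ioi (0 : ℝ) ∈ 𝓝[>] 0)).exists
  refine ⟨c, hc0, fun x => ?_⟩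
  have := Matrix.PosSemidef.matrixQuadForm_nonneg hc x
  rw [AddSubgroupClass.coe_sub, sub_eq_add_neg, matrixQuadForm_add, matrixQuadForm_neg,
    NegMemClass.coe_neg, matrixQuadForm_neg, selfAdjoint.val_smul, matrixQuadForm_smul,
    selfAdjoint.val_one, matrixQuadForm_one] at this
  linarith

lemma matrixQuadForm_hessMatrix (ψ : EucSp n → ℝ) (x h : EucSp n) :
    matrixQuadForm (hessMatrix ψ x) h = fderiv ℝ (fderiv ℝ ψ) x h h := by
  have hh : h = ∑ i, h i • EuclideanSpace.single i (1 : ℝ) := by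
    have := (EuclideanSpace.basisFun (Fin n) ℝ).sum_repr h
    simpa using this.symm
  conv_rhs => rw [hh]
  simp only [map_sum, map_smul, sum_apply, smul_apply,
    smul_eq_mul, matrixQuadForm, hessMatrix, iteratedFDeriv_two_apply, Matrix.of_apply,
    Finset.mul_sum]
  rw [Finset.sum_comm]
  exact Finset.sum_congr rfl fun i _ => Finset.sum_congr rfl fun j _ => by simp; ring

lemma ContDiffAt.hessMatrix_mem_selfAdjoint {ψ : EucSp n → ℝ} {x : EucSp n}
    (hψ : ContDiffAt ℝ 2 ψ x) :
    hessMatrix ψ x ∈ selfAdjoint (Matrix (Fin n) (Fin n) ℝ) := by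
  rw [selfAdjoint.mem_iff]
  ext i j
  simp only [Matrix.star_apply, star_trivial, hessMatrix, iteratedFDeriv_two_apply,
    Matrix.of_apply]
  exact hψ.isSymmSndFDerivAt (by simp) _ _

lemma ContDiffAt.eventually_le_of_matrixQuadForm_hessMatrix_le {ψ : EucSp n → ℝ} {x : EucSp n}
    (hψ : ContDiffAt ℝ 2 ψ x) {c : ℝ}
    (hc : ∀ h, matrixQuadForm (hessMatrix ψ x) h ≤ c * ‖h‖ ^ 2) {d : ℝ} (hd : c / 2 < d) :
    ∃ l : EucSp n, ∀ᶠ y in 𝓝 x, ψ y ≤ ψ x + ⟪l, y - x⟫ + d * ‖y - x‖ ^ 2 := by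
  have h1 : ∀ᶠ y in 𝓝 x, HasFDerivAt ψ (fderiv ℝ ψ y) y := by
    filter_upwards [hψ.eventually (by simp)] with y hy
    exact (hy.differentiableAt (by simp)).hasFDerivAt
  have h2 : HasFDerivAt (fderiv ℝ ψ) (fderiv ℝ (fderiv ℝ ψ) x) x :=
    ((hψ.fderiv_right (m := 1) (by norm_num)).differentiableAt (by simp)).hasFDerivAt
  refine ⟨(InnerProductSpace.toDual ℝ (EucSp n)).symm (fderiv ℝ ψ x), ?_⟩
  filter_upwards [eventually_abs_taylor_two_le h1 h2 (sub_pos.2 hd)] with y hy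
  have h3 := (abs_le.1 hy).2
  have h4 := hc (y - x)
  rw [matrixQuadForm_hessMatrix] at h4
  rw [InnerProductSpace.toDual_symm_apply]
  linarith

lemma contDiff_quadratic (s : ℝ) (a x : EucSp n) (T : EucSp n →L[ℝ] EucSp n) :
    ContDiff ℝ 2 fun y => s + ⟪a, y - x⟫ + 1 / 2 * ⟪T (y - x), y - x⟫ := by
  have : ContDiff ℝ 2 fun y : EucSp n => y - x := by fun_prop
  have h2 : ContDiff ℝ 2 fun y : EucSp n => T (y - x) := T.contDiff.comp this
  exact (contDiff_const.add (contDiff_const.inner ℝ this)).add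
    (contDiff_const.mul (h2.inner ℝ this))

lemma matrixQuadForm_hessMatrix_quadratic (s : ℝ) (a x h : EucSp n)
    (T : EucSp n →L[ℝ] EucSp n) :
    matrixQuadForm (hessMatrix (fun y => s + ⟪a, y - x⟫ + 1 / 2 * ⟪T (y - x), y - x⟫) x) h =
      ⟪T h, h⟫ := by
  have hψ := contDiff_quadratic s a x T
  rw [matrixQuadForm_hessMatrix]
  set ψ : EucSp n → ℝ := fun y => s + ⟪a, y - x⟫ + 1 / 2 * ⟪T (y - x), y - x⟫ with hψdef
  have h1 : ∀ y, fderiv ℝ ψ y h = ⟪a, h⟫ + 1 / 2 * (⟪T (y - x), h⟫ + ⟪T h, y - x⟫) := fun y => by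
    have e1 : HasFDerivAt (fun y : EucSp n => y - x) (ContinuousLinearMap.id ℝ _) y :=
      (hasFDerivAt_id y).sub_const x
    have e2 : HasFDerivAt (fun y : EucSp n => T (y - x)) (T.comp (ContinuousLinearMap.id ℝ _)) y :=
      T.hasFDerivAt.comp y e1
    have e3 := ((((hasFDerivAt_const a y).inner ℝ e1).const_add s).add
      ((e2.inner ℝ e1).const_mul (1 / 2)))
    rw [HasFDerivAt.fderiv (f := ψ) e3]
    simp
  have h2 : HasFDerivAt (fderiv ℝ ψ) (fderiv ℝ (fderiv ℝ ψ) x) x :=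
    ((hψ.fderiv_right (m := 1) (by norm_num)).differentiable (by simp) x).hasFDerivAt
  have h3 : HasDerivAt (fun t : ℝ => fderiv ℝ ψ (x + t • h) h)
      (fderiv ℝ (fderiv ℝ ψ) x h h) 0 := by
    have e1 : HasDerivAt (fun t : ℝ => x + t • h) h 0 := by
      simpa using ((hasDerivAt_id (0 : ℝ)).smul_const h).const_add x
    have e2 : HasFDerivAt (fderiv ℝ ψ) (fderiv ℝ (fderiv ℝ ψ) x) (x + (0 : ℝ) • h) := by
      simpa using h2
    have e3 : HasFDerivAt (fun y => fderiv ℝ ψ y h)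
        ((ContinuousLinearMap.apply ℝ ℝ h).comp (fderiv ℝ (fderiv ℝ ψ) x)) (x + (0 : ℝ) • h) :=
      (ContinuousLinearMap.apply ℝ ℝ h).hasFDerivAt.comp (x + (0 : ℝ) • h) e2
    exact e3.comp_hasDerivAt (0 : ℝ) e1
  have h4 : HasDerivAt (fun t : ℝ => fderiv ℝ ψ (x + t • h) h) ⟪T h, h⟫ 0 := by
    have : (fun t : ℝ => fderiv ℝ ψ (x + t • h) h) = fun t : ℝ => ⟪a, h⟫ + t * ⟪T h, h⟫ := by
      ext t
      rw [h1, add_sub_cancel_left, map_smul, inner_smul_left, inner_smul_right]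
      simp only [conj_trivial]
      ring
    rw [this]
    simpa using ((hasDerivAt_id (0 : ℝ)).mul_const ⟪T h, h⟫).const_add ⟪a, h⟫
  exact h3.unique h4

end QuadraticForms

section SumsOfSubharmonics

open scoped RealInnerProductSpace

variable {X : Set (EucSp n)} {v w : EucSp n → EReal} {x₀ : EucSp n}

/-- A quadratic upper expansion provides a test function, hence a matrix in `S` whose quadratic
form is controlled by the expansion. -/
lemma FSubharmonicOn.exists_mem_matrixQuadForm_eq {S : Set (SymMat n)}
    (hv : FSubharmonicOn S X v) (hx₀ : x₀ ∈ X) {s η : ℝ} {a : EucSp n}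
    {A : EucSp n →L[ℝ] EucSp n} (hs : v x₀ = s)
    (hA : ∀ᶠ q in 𝓝 x₀, v q ≤ ((s + ⟪a, q - x₀⟫ + 1 / 2 * ⟪A (q - x₀), q - x₀⟫ +
      η * ‖q - x₀‖ ^ 2 : ℝ) : EReal)) :
    ∃ D ∈ S, ∀ h, matrixQuadForm (D : Matrix (Fin n) (Fin n) ℝ) h =
      ⟪A h, h⟫ + 2 * η * ‖h‖ ^ 2 := by
  set T : EucSp n →L[ℝ] EucSp n := A + (2 * η) • ContinuousLinearMap.id ℝ _ with hT
  have hTh : ∀ h, ⟪T h, h⟫ = ⟪A h, h⟫ + 2 * η * ‖h‖ ^ 2 := fun h => by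
    simp only [hT, add_apply, smul_apply, ContinuousLinearMap.id_apply, inner_add_left,
      inner_smul_left, conj_trivial, real_inner_self_eq_norm_sq]
  have htest : IsTestAt X v (fun y => s + ⟪a, y - x₀⟫ + 1 / 2 * ⟪T (y - x₀), y - x₀⟫) x₀ := by
    refine ⟨(contDiff_quadratic s a x₀ T).contDiffAt, ?_, by simpa using hs⟩
    filter_upwards [hA.filter_mono nhdsWithin_le_nhds] with q hq
    refine hq.trans (EReal.coe_le_coe_iff.2 ?_)
    rw [hTh]
    linarith
  obtain ⟨D, hD, hDe⟩ := hv.2.2 x₀ hx₀ _ htest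
  exact ⟨D, hD, fun h => by rw [hDe, matrixQuadForm_hessMatrix_quadratic, hTh]⟩

/-- The sum of an `F`-subharmonic and a dual subharmonic function has no strict quadratic
maximum relative to affine functions. -/
lemma ConeSubequation.not_eventually_add_le (F : ConeSubequation n) (hX : IsOpen X)
    (hv : FSubharmonicOn F.carrier X v) (hw : FSubharmonicOn (dualSet F.carrier) X w)
    (hx₀ : x₀ ∈ X) {u₀ κ : ℝ} (hκ : 0 < κ) (p₀ : EucSp n) (hu₀ : v x₀ + w x₀ = (u₀ : EReal)) :
    ¬ ∀ᶠ x in 𝓝 x₀, v x + w x ≤ ((u₀ + ⟪p₀, x - x₀⟫ - κ * ‖x - x₀‖ ^ 2 : ℝ) : EReal) := by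
  intro hle
  obtain ⟨r, hr, hball⟩ := Metric.nhds_basis_closedBall.mem_iff.1
    (hle.and (hX.mem_nhds hx₀))
  have hBX : Metric.closedBall x₀ r ⊆ X := fun x hx => (hball hx).2
  obtain ⟨x, hx, y, hy, s, t, a, b, A, B, hs, ht, hA, hB, hAB⟩ :=
    exists_upper_expansions_of_strict_max (p₀ := p₀) (κ := κ / 2) (η := κ / 10) hr (by positivity)
      (by positivity) (hv.1.mono hBX) (hw.1.mono hBX) (fun x hx => hv.2.1 x (hBX hx))
      (fun x hx => hw.2.1 x (hBX hx)) hu₀ fun x hx => (hball hx).1.trans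
        (EReal.coe_le_coe_iff.2 (by linarith))
  obtain ⟨D, hD, hDq⟩ := hv.exists_mem_matrixQuadForm_eq
    (hBX (Metric.ball_subset_closedBall hx)) hs hA
  obtain ⟨G, hG, hGq⟩ := hw.exists_mem_matrixQuadForm_eq
    (hBX (Metric.ball_subset_closedBall hy)) ht hB
  refine hG (F.mem_interior_of_matrixQuadForm_le hD (by positivity : 0 < κ / 2) fun h => ?_)
  rw [NegMemClass.coe_neg, matrixQuadForm_neg, hDq, hGq]
  linarith [hAB h]

lemma IsTestAt.exists_eventually_le_of_notMem_dualSet_posP {W : Set (EucSp n)} (hW : IsOpen W)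
    (hx₀ : x₀ ∈ W) {u : EucSp n → EReal} {ψ : EucSp n → ℝ} (hψ : IsTestAt W u ψ x₀)
    (hmem : hessMatrix ψ x₀ ∉ Subtype.val '' dualSet (PosP n)) :
    ∃ κ > 0, ∃ l : EucSp n, ∀ᶠ x in 𝓝 x₀,
      u x ≤ ((ψ x₀ + ⟪l, x - x₀⟫ - κ * ‖x - x₀‖ ^ 2 : ℝ) : EReal) := by
  obtain ⟨hC, hle, -⟩ := hψ
  obtain ⟨c, hc, hcq⟩ := exists_matrixQuadForm_le_of_neg_mem_interior
    (A := ⟨hessMatrix ψ x₀, hC.hessMatrix_mem_selfAdjoint⟩) (by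
      by_contra hcon
      exact hmem ⟨_, hcon, rfl⟩)
  obtain ⟨l, hl⟩ := hC.eventually_le_of_matrixQuadForm_hessMatrix_le hcq
    (by linarith : -c / 2 < -(c / 4))
  rw [hW.nhdsWithin_eq hx₀] at hle
  refine ⟨c / 4, by positivity, l, ?_⟩
  filter_upwards [hle, hl] with x hx hx'
  exact hx.trans (EReal.coe_le_coe_iff.2 (by linarith))

lemma EReal.coe_mul_add_le_coe {a b : EReal} (ha : a ≠ ⊤) (hb : b ≠ ⊤) {τ c : ℝ} (hτ : 0 < τ)
    (h : ∀ s t : ℝ, a = s → b = t → τ * s + t ≤ c) : (τ : EReal) * a + b ≤ (c : EReal) := by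
  induction a using EReal.rec with
  | top => exact absurd rfl ha
  | bot => simp [EReal.coe_mul_bot_of_pos hτ]
  | coe a =>
    induction b using EReal.rec with
    | top => exact absurd rfl hb
    | bot => simp
    | coe b => exact_mod_cast h a b rfl rfl

lemma EReal.continuous_coe_mul_of_pos {τ : ℝ} (hτ : 0 < τ) :
    Continuous fun a : EReal => (τ : EReal) * a := by
  have h0 : (τ : EReal) ≠ 0 := by exact_mod_cast hτ.ne'
  refine continuous_iff_continuousAt.2 fun a => ?_
  have h1 : ContinuousAt (fun p : EReal × EReal => p.1 * p.2) ((τ : EReal), a) :=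
    EReal.continuousAt_mul (Or.inl h0) (Or.inl h0) (Or.inl (EReal.coe_ne_bot _))
      (Or.inl (EReal.coe_ne_top _))
  exact h1.comp (f := fun a : EReal => ((τ : EReal), a)) (by fun_prop)

lemma ConeSubequation.fSubharmonicOn_const_mul (F : ConeSubequation n)
    (hv : FSubharmonicOn F.carrier X v) {τ : ℝ} (hτ : 0 < τ) :
    FSubharmonicOn F.carrier X fun x => (τ : EReal) * v x := by
  refine ⟨?_, fun x hx (h : (τ : EReal) * v x = ⊤) => ?_, fun x hx ψ hψ => ?_⟩
  · exact (EReal.continuous_coe_mul_of_pos hτ).comp_upperSemicontinuousOn hv.1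
      fun a b hab => mul_le_mul_of_nonneg_left hab (EReal.coe_nonneg.2 hτ.le)
  · have := EReal.coe_mul_add_le_coe (b := 0) (c := τ * (v x).toReal) (hv.2.1 x hx)
      EReal.zero_ne_top hτ fun s t hs ht => by
        rw [hs, EReal.toReal_coe]
        have : t = 0 := by exact_mod_cast ht.symm
        linarith
    rw [add_zero, h, top_le_iff] at this
    exact EReal.coe_ne_top _ this
  · obtain ⟨hC, hle, heq : (τ : EReal) * v x = _⟩ := hψ
    have hdiv : ∀ y, (τ⁻¹ : ℝ) * ((τ : EReal) * v y) = v y := fun y => by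
      rw [← mul_assoc, ← EReal.coe_mul, inv_mul_cancel₀ hτ.ne', EReal.coe_one, one_mul]
    have hτ' : (0 : EReal) ≤ (τ⁻¹ : ℝ) := EReal.coe_nonneg.2 (inv_nonneg.2 hτ.le)
    have htest : IsTestAt X v (fun y => τ⁻¹ • ψ y) x := by
      refine ⟨hC.const_smul _, ?_, ?_⟩
      · filter_upwards [hle] with y hy
        rw [← hdiv y, smul_eq_mul, EReal.coe_mul]
        exact mul_le_mul_of_nonneg_left hy hτ'
      · rw [← hdiv x, heq, ← EReal.coe_mul]; rfl
    obtain ⟨D, hD, hDe⟩ := hv.2.2 x hx _ htest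
    refine ⟨τ • D, F.f2 D hD τ hτ, ?_⟩
    rw [selfAdjoint.val_smul, hDe]
    ext i j
    have := iteratedFDeriv_const_smul_apply (𝕜 := ℝ) (i := 2) (a := τ⁻¹) (f := ψ) (x := x) hC
    simp only [Matrix.smul_apply, hessMatrix, Matrix.of_apply]
    change τ • (iteratedFDeriv ℝ 2 (τ⁻¹ • ψ) x) _ = _
    rw [this]
    simp [hτ.ne']

end SumsOfSubharmonics

section PolarSingularity

open scoped RealInnerProductSpace

/-- At a point where the singular function tends to `-∞`, the upper limit of the sum cannot be a
strict quadratic maximum relative to affine functions. -/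
lemma ConeSubequation.false_of_polar_strict_max (F : ConeSubequation n) {X : Set (EucSp n)}
    (hX : IsOpen X) {v w : EucSp n → EReal} (hv : FSubharmonicOn F.carrier X v)
    (hw : FSubharmonicOn (dualSet F.carrier) X w) {x₀ l : EucSp n} {H : EucSp n → ℝ}
    {r c k M u₀ κ : ℝ} (hr : 0 < r) (hκ : 0 < κ)
    (hball : ∀ x ∈ Metric.closedBall x₀ r, x ≠ x₀ → x ∈ X)
    (hvH : ∀ x ∈ Metric.closedBall x₀ r, x ≠ x₀ → v x ≤ ((H x + c : ℝ) : EReal))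
    (hwH : ∀ x ∈ Metric.closedBall x₀ r, x ≠ x₀ → w x ≤ ((-H x + k : ℝ) : EReal))
    (hHM : ∀ x ∈ Metric.closedBall x₀ r, x ≠ x₀ → H x ≤ M)
    (hH : Tendsto H (𝓝[≠] x₀) atBot)
    (hfreq : ∀ a : ℝ, a < u₀ → ∃ᶠ x in 𝓝[≠] x₀, (a : EReal) < v x + w x)
    (hle : ∀ x ∈ Metric.closedBall x₀ r, x ≠ x₀ →
      v x + w x ≤ ((u₀ + ⟪l, x - x₀⟫ - κ * ‖x - x₀‖ ^ 2 : ℝ) : EReal)) : False := by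
  set q : EucSp n → ℝ := fun x => -⟪l, x - x₀⟫ + κ / 2 * ‖x - x₀‖ ^ 2 with hq
  have hqc : Continuous q := by fun_prop
  have hq0 : q x₀ = 0 := by simp [hq]
  have hnear : ∀ᶠ x in 𝓝[≠] x₀, x ∈ Metric.ball x₀ r ∧ x ≠ x₀ ∧ -(κ * r ^ 2 / 8) < q x := by
    have h1 : ∀ᶠ x in 𝓝 x₀, x ∈ Metric.ball x₀ r := Metric.ball_mem_nhds x₀ hr
    have h2 : ∀ᶠ x in 𝓝 x₀, -(κ * r ^ 2 / 8) < q x :=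
      (hqc.tendsto x₀).eventually (lt_mem_nhds (by rw [hq0]; simp; positivity))
    filter_upwards [h1.filter_mono nhdsWithin_le_nhds, h2.filter_mono nhdsWithin_le_nhds,
      self_mem_nhdsWithin] with x hx1 hx2 hx3
    exact ⟨hx1, hx3, hx2⟩
  obtain ⟨y, hyu, hyr, hyx₀, hyq⟩ :=
    ((hfreq (u₀ - κ * r ^ 2 / 8) (by linarith [mul_pos hκ (pow_pos hr 2)])).and_eventually
      hnear).exists
  have hyB := Metric.ball_subset_closedBall hyr
  have hyX := hball y hyB hyx₀
  have hsum_bot : v y + w y ≠ ⊥ := (EReal.bot_lt_coe _ |>.trans hyu).ne'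
  rw [Ne, EReal.add_eq_bot_iff, not_or] at hsum_bot
  obtain ⟨s₀, hs₀⟩ : ∃ s : ℝ, v y = s :=
    ⟨_, (EReal.coe_toReal (hv.2.1 y hyX) hsum_bot.1).symm⟩
  obtain ⟨t₀, ht₀⟩ : ∃ t : ℝ, w y = t :=
    ⟨_, (EReal.coe_toReal (hw.2.1 y hyX) hsum_bot.2).symm⟩
  have hst : u₀ - κ * r ^ 2 / 8 < s₀ + t₀ := by
    rw [hs₀, ht₀] at hyu
    exact_mod_cast hyu
  have hs₀M : s₀ ≤ M + c := by
    have h1 := hvH y hyB hyx₀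
    rw [hs₀] at h1
    norm_cast at h1
    linarith [hHM y hyB hyx₀]
  have hκr : 0 < κ * r ^ 2 := by positivity
  obtain ⟨ε, hε, hεM⟩ : ∃ ε > 0, ε * (M + c - s₀) < κ * r ^ 2 / 4 := by
    refine ⟨κ * r ^ 2 / 4 / (M + c - s₀ + 1), by apply div_pos <;> linarith, ?_⟩
    rw [div_mul_eq_mul_div, div_lt_iff₀ (by linarith)]
    nlinarith
  have hτ : (0 : ℝ) < 1 + ε := by linarith
  have hv' := F.fSubharmonicOn_const_mul hv hτ
  set γ := (1 + ε) * s₀ + t₀ + q y with hγ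
  set G : EucSp n → EReal := fun x => (((1 + ε : ℝ) : EReal) * v x + w x) + (q x : EReal) with hG
  have hGy : G y = (γ : EReal) := by
    simp only [hG, hs₀, ht₀, hγ]
    norm_cast
  have hGle : ∀ x ∈ X, ∀ a : ℝ, (∀ s t : ℝ, v x = s → w x = t → (1 + ε) * s + t + q x ≤ a) →
      G x ≤ (a : EReal) := fun x hx a h => by
    have h1 := EReal.coe_mul_add_le_coe (c := a - q x) (hv.2.1 x hx) (hw.2.1 x hx) hτ
      fun s t hs ht => by linarith [h s t hs ht]
    calc G x ≤ ((a - q x : ℝ) : EReal) + (q x : EReal) := add_le_add_left h1 _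
      _ = (a : EReal) := by norm_cast; ring
  have hpunct : ∀ᶠ x in 𝓝[≠] x₀, x ∈ Metric.closedBall x₀ r → G x ≤ (γ : EReal) := by
    filter_upwards [hH.eventually_le_atBot
      ((γ - (1 + ε) * c - k - κ / 2 * r ^ 2 - ‖l‖ * r) / ε), self_mem_nhdsWithin] with x hx hxne hxB
    refine hGle x (hball x hxB hxne) γ fun s t hs ht => ?_
    have h1 := hvH x hxB hxne
    have h2 := hwH x hxB hxne
    rw [hs] at h1
    rw [ht] at h2
    norm_cast at h1 h2
    rw [le_div_iff₀ hε] at hx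
    rw [mem_closedBall_iff_norm] at hxB
    have h3 : q x ≤ ‖l‖ * r + κ / 2 * r ^ 2 := by
      have h4 := (neg_le_abs ⟪l, x - x₀⟫).trans (abs_real_inner_le_norm l (x - x₀))
      have h5 : ‖l‖ * ‖x - x₀‖ ≤ ‖l‖ * r := by gcongr
      have h6 : κ / 2 * ‖x - x₀‖ ^ 2 ≤ κ / 2 * r ^ 2 := by gcongr
      simp only [hq]
      linarith
    have h7 := mul_le_mul_of_nonneg_left h1 hτ.le
    linarith
  obtain ⟨ρ, hρ, hρG⟩ := Metric.eventually_nhds_iff_ball.1 (eventually_nhdsWithin_iff.1 hpunct)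
  set ρ' := min ρ ‖y - x₀‖ with hρ'
  have hρ'pos : 0 < ρ' := lt_min hρ (norm_pos_iff.2 (sub_ne_zero.2 hyx₀))
  set K : Set (EucSp n) := Metric.closedBall x₀ r ∩ {x | ρ' ≤ ‖x - x₀‖} with hK
  have hKc : IsCompact K := (isCompact_closedBall x₀ r).inter_right
    (isClosed_le continuous_const (by fun_prop))
  have hKne : ∀ x ∈ K, x ≠ x₀ := fun x hx h => by
    have : ρ' ≤ ‖x - x₀‖ := hx.2
    rw [h, sub_self, norm_zero] at this
    linarith
  have hKX : K ⊆ X := fun x hx => hball x hx.1 (hKne x hx)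
  have hyK : y ∈ K := ⟨hyB, (min_le_right _ _ : ρ' ≤ ‖y - x₀‖)⟩
  have hGusc : UpperSemicontinuousOn G K := by
    refine UpperSemicontinuousOn.add_coe_of_continuous ?_ hqc
    exact (hv'.1.mono hKX).add' (hw.1.mono hKX) fun x hx => EReal.continuousAt_add
      (Or.inl (hv'.2.1 x (hKX hx))) (Or.inr (hw.2.1 x (hKX hx)))
  obtain ⟨x₁, hx₁, hmax⟩ := hGusc.exists_isMaxOn ⟨y, hyK⟩ hKc
  have hγx₁ : (γ : EReal) ≤ G x₁ := hGy ▸ hmax hyK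
  have hx₁X := hKX hx₁
  have hx₁r : x₁ ∈ Metric.ball x₀ r := by
    rw [mem_ball_iff_norm]
    have hx₁B := hx₁.1
    rw [mem_closedBall_iff_norm] at hx₁B
    refine lt_of_le_of_ne hx₁B fun heq => ?_
    have h1 : G x₁ ≤ ((u₀ - κ / 2 * r ^ 2 + ε * (M + c) : ℝ) : EReal) :=
      hGle x₁ hx₁X _ fun s t hs ht => by
        have h1 := hvH x₁ hx₁.1 (hKne _ hx₁)
        have h2 := hle x₁ hx₁.1 (hKne _ hx₁)
        rw [hs] at h1
        rw [hs, ht] at h2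
        norm_cast at h1 h2
        have h3 := hHM x₁ hx₁.1 (hKne _ hx₁)
        have h4 : ε * s ≤ ε * (M + c) := by gcongr; linarith
        rw [heq] at h2
        simp only [hq]
        rw [heq]
        linarith
    have h2 := hγx₁.trans h1
    norm_cast at h2
    linarith
  obtain ⟨u₁, hu₁⟩ : ∃ u : ℝ, ((1 + ε : ℝ) : EReal) * v x₁ + w x₁ = u := by
    refine ⟨_, (EReal.coe_toReal (EReal.add_ne_top (hv'.2.1 x₁ hx₁X) (hw.2.1 x₁ hx₁X))
      fun h => ?_).symm⟩
    simp only [hG] at hγx₁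
    rw [h, EReal.bot_add] at hγx₁
    exact (EReal.bot_lt_coe γ).not_ge hγx₁
  refine F.not_eventually_add_le hX hv' hw hx₁X (by positivity : 0 < κ / 2)
    (l - κ • (x₁ - x₀)) hu₁ ?_
  have hne : ∀ᶠ x in 𝓝 x₁, x ≠ x₀ := isOpen_ne.mem_nhds (hKne _ hx₁)
  filter_upwards [hne, Metric.isOpen_ball.mem_nhds hx₁r] with x hxne hxr
  have hxB := Metric.ball_subset_closedBall hxr
  have hxG : G x ≤ G x₁ := by
    by_cases hxK : ρ' ≤ ‖x - x₀‖
    · exact hmax ⟨hxB, hxK⟩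
    · refine (hρG x ?_ hxne hxB).trans hγx₁
      rw [mem_ball_iff_norm]
      exact (not_le.1 hxK).trans_le (min_le_left _ _)
  refine EReal.coe_mul_add_le_coe (hv.2.1 x (hball x hxB hxne)) (hw.2.1 x (hball x hxB hxne)) hτ
    fun s t hs ht => ?_
  simp only [hG] at hxG
  rw [hu₁, hs, ht] at hxG
  norm_cast at hxG
  have h1 : x - x₀ = (x - x₁) + (x₁ - x₀) := by abel
  have h2 : q x = q x₁ - ⟪l - κ • (x₁ - x₀), x - x₁⟫ + κ / 2 * ‖x - x₁‖ ^ 2 := by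
    simp only [hq]
    rw [h1, norm_add_sq_real, inner_add_right, inner_sub_left l, inner_smul_left,
      real_inner_comm (x₁ - x₀) (x - x₁)]
    simp only [conj_trivial]
    ring
  linarith

end PolarSingularity

/-- Lemma 5.1, polar case: if v is F-subharmonic and w is F̃-subharmonic on
a deleted neighborhood of x₀, h is a downward-pointing singular F-harmonic of polar type
at x₀, and v ≤ h + c, w ≤ −h + k near x₀, then u = v + w, extended to x₀ by
u(x₀) = limsup_{x→x₀}(v + w), is subaffine on a neighborhood of x₀. -/
theorem dirichlet_singularities_stmt4 {n : ℕ} (F : ConeSubequation n) (x₀ : EucSp n)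
    (U V : Set (EucSp n)) (hU : IsOpen U) (hx₀ : x₀ ∈ U)
    (h : EucSp n → EReal) (hh : DPSingular F V x₀ h) (hpolar : h x₀ = ⊥)
    (v w : EucSp n → EReal)
    (hv : FSubharmonicOn F.carrier (U \ {x₀}) v)
    (hw : FSubharmonicOn (dualSet F.carrier) (U \ {x₀}) w)
    (c k : ℝ)
    (hvb : ∀ᶠ y in 𝓝[≠] x₀, v y ≤ h y + (c : EReal))
    (hwb : ∀ᶠ y in 𝓝[≠] x₀, w y ≤ -(h y) + (k : EReal)) :
    ∃ W : Set (EucSp n), IsOpen W ∧ x₀ ∈ W ∧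
      SubaffineOn W (Function.update (fun y => v y + w y) x₀
        (Filter.limsup (fun y => v y + w y) (𝓝[≠] x₀))) := by
  have hV : V ∈ 𝓝 x₀ := hh.isOpen'.mem_nhds hh.mem
  obtain ⟨ρ, hρ, hρO⟩ := Metric.mem_nhds_iff.1 (inter_mem (inter_mem (hU.mem_nhds hx₀) hV)
    (inter_mem (eventually_nhdsWithin_iff.1 hvb) (eventually_nhdsWithin_iff.1 hwb)))
  have hX : IsOpen (U \ {x₀}) := hU.sdiff isClosed_singleton
  have hWX : ∀ x ∈ Metric.ball x₀ ρ, x ≠ x₀ → x ∈ U \ {x₀} := fun x hx hne =>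
    ⟨(hρO hx).1.1, hne⟩
  obtain ⟨H, hHh⟩ : ∃ H : EucSp n → ℝ, ∀ x ∈ Metric.ball x₀ ρ, x ≠ x₀ → h x = (H x : EReal) :=
    ⟨fun x => (h x).toReal, fun x hx hne => (EReal.coe_toReal (hh.subh.2.1 x (hρO hx).1.2)
      (hpolar ▸ hh.strictMin x (hρO hx).1.2 hne).ne').symm⟩
  have hvH : ∀ x ∈ Metric.ball x₀ ρ, x ≠ x₀ → v x ≤ ((H x + c : ℝ) : EReal) := fun x hx hne => by
    have := (hρO hx).2.1 hne
    rw [hHh x hx hne] at this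
    exact_mod_cast this
  have hwH : ∀ x ∈ Metric.ball x₀ ρ, x ≠ x₀ → w x ≤ ((-H x + k : ℝ) : EReal) := fun x hx hne => by
    have := (hρO hx).2.2 hne
    rw [hHh x hx hne] at this
    exact_mod_cast this
  have hbd : ∀ x ∈ Metric.ball x₀ ρ, x ≠ x₀ → v x + w x ≤ ((c + k : ℝ) : EReal) :=
    fun x hx hne => (add_le_add (hvH x hx hne) (hwH x hx hne)).trans_eq (by norm_cast; ring)
  set u₀ := limsup (fun y => v y + w y) (𝓝[≠] x₀) with hu₀
  set u := Function.update (fun y => v y + w y) x₀ u₀ with hu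
  have hux : ∀ x, x ≠ x₀ → u x = v x + w x := fun x hx => Function.update_of_ne hx _ _
  have hux₀ : u x₀ = u₀ := Function.update_self _ _ _
  have hnhds : ∀ x ∈ Metric.ball x₀ ρ, x ≠ x₀ → ∀ᶠ y in 𝓝 x, u y = v y + w y :=
    fun x hx hne => Filter.Eventually.mono (isOpen_ne.mem_nhds hne) hux
  refine ⟨Metric.ball x₀ ρ, Metric.isOpen_ball, Metric.mem_ball_self hρ, ?_, fun x hx => ?_,
    fun x hx ψ hψ => ?_⟩
  · have husc : UpperSemicontinuousOn (fun x => v x + w x) (U \ {x₀}) :=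
      hv.1.add' hw.1 fun x hx => EReal.continuousAt_add (Or.inl (hv.2.1 x hx))
        (Or.inr (hw.2.1 x hx))
    intro x hx a ha
    refine Filter.Eventually.filter_mono nhdsWithin_le_nhds ?_
    rcases eq_or_ne x x₀ with rfl | hne
    · have h1 := eventually_lt_of_limsup_lt (hux₀ ▸ ha)
      filter_upwards [eventually_nhdsWithin_iff.1 h1] with y hy
      rcases eq_or_ne y x with rfl | hyx
      · exact ha
      · rw [hux y hyx]
        exact hy hyx
    · have h1 := husc x (hWX x hx hne) a ((hux x hne).symm.trans_lt ha)
      rw [hX.nhdsWithin_eq (hWX x hx hne)] at h1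
      filter_upwards [h1, hnhds x hx hne] with y hy hyu
      rwa [hyu]
  · rcases eq_or_ne x x₀ with rfl | hne
    · rw [hux₀]
      refine ne_top_of_le_ne_top (EReal.coe_ne_top (c + k)) (limsup_le_of_le (by isBoundedDefault) ?_)
      filter_upwards [nhdsWithin_le_nhds (Metric.ball_mem_nhds x hρ), self_mem_nhdsWithin]
        with y hy hyx
      exact hbd y hy hyx
    · rw [hux x hne]
      exact ne_top_of_le_ne_top (EReal.coe_ne_top _) (hbd x hx hne)
  · by_contra hcon
    obtain ⟨κ, hκ, l, hl⟩ := hψ.exists_eventually_le_of_notMem_dualSet_posP Metric.isOpen_ball hx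
      hcon
    rcases eq_or_ne x x₀ with rfl | hne
    · have hψx : u₀ = (ψ x : EReal) := hux₀ ▸ hψ.2.2
      obtain ⟨r, hr, hball⟩ := Metric.nhds_basis_closedBall.mem_iff.1
        (inter_mem hl (Metric.ball_mem_nhds x hρ))
      have hhc : UpperSemicontinuousOn h (Metric.closedBall x r) :=
        (hh.cont.mono fun y hy => (hρO (hball hy).2).1.2).upperSemicontinuousOn
      obtain ⟨M, hM⟩ := hhc.exists_real_forall_le (isCompact_closedBall x r)
        fun y hy => hh.subh.2.1 y (hρO (hball hy).2).1.2
      have hH : Tendsto H (𝓝[≠] x) atBot := by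
        have h1 : Tendsto h (𝓝 x) (𝓝 ⊥) := hpolar ▸ (hh.cont.continuousAt hV).tendsto
        refine tendsto_atBot.2 fun a => ?_
        have h2 := h1.eventually (gt_mem_nhds (EReal.bot_lt_coe a))
        filter_upwards [h2.filter_mono nhdsWithin_le_nhds, self_mem_nhdsWithin,
          nhdsWithin_le_nhds (Metric.ball_mem_nhds x hρ)] with y hy hyx hyρ
        rw [hHh y hyρ hyx] at hy
        exact_mod_cast hy.le
      refine F.false_of_polar_strict_max hX hv hw hr hκ (fun y hy => hWX y (hball hy).2)
        (fun y hy => hvH y (hball hy).2) (fun y hy => hwH y (hball hy).2) (M := M)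
        (fun y hy hyx => ?_) hH (u₀ := ψ x) (fun a ha => ?_) (l := l) fun y hy hyx => ?_
      · have := hM y hy
        rw [hHh y (hball hy).2 hyx] at this
        exact_mod_cast this
      · refine frequently_lt_of_lt_limsup (by isBoundedDefault) ?_
        rw [← hu₀, hψx]
        exact_mod_cast ha
      · rw [← hux y hyx]
        exact (hball hy).1
    · refine F.not_eventually_add_le hX hv hw (hWX x hx hne) hκ l (u₀ := ψ x)
        (by rw [← hux x hne, hψ.2.2]) ?_
      filter_upwards [hl, hnhds x hx hne] with y hy hyu
      rwa [← hyu]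
end
end

section
/- Let F be a cone subequation on ℝⁿ with dual F̃, Ω ⊂ ℝⁿ a bounded domain, x₁,…,x_k ∈ Ω, and for each j let h_j be a downward-pointing singular F-harmonic of polar type at x_j. Let v, w be upper semicontinuous on Ω̄ ∖ {x₁,…,x_k}, with v F-subharmonic and w F̃-subharmonic on Ω ∖ {x₁,…,x_k}, and suppose that near each x_j there are constants c_j and k_j with v ≤ h_j + c_j and w ≤ −h_j + k_j. If v + w ≤ 0 on ∂Ω, then v + w ≤ 0 on Ω ∖ {x₁,…,x_k}. -/
open scoped Topology Classical
open Filter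

noncomputable section

variable {n : ℕ}

section Regularization

variable {E : Type*} [NormedAddCommGroup E]

/-- `s` is the quadratic sup-convolution of `U` over `C`, with all suprema attained. -/
def IsSupConv (C : Set E) (U : E → ℝ) (c : ℝ) (s : E → ℝ) : Prop :=
  ∀ z, IsGreatest ((fun y => U y - c * ‖z - y‖ ^ 2) '' C) (s z)

lemma exists_isSupConv {C : Set E} (hC : IsCompact C) (hne : C.Nonempty) {U : E → ℝ}
    (hU : UpperSemicontinuousOn U C) (c : ℝ) : ∃ s, IsSupConv C U c s := by
  have key : ∀ z : E, ∃ r, IsGreatest ((fun y => U y - c * ‖z - y‖ ^ 2) '' C) r := by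
    intro z
    have hcont : Continuous fun y : E => -(c * ‖z - y‖ ^ 2) := by fun_prop
    have husc : UpperSemicontinuousOn (fun y => U y - c * ‖z - y‖ ^ 2) C := by
      simpa [sub_eq_add_neg] using
        hU.add (hcont.upperSemicontinuous.upperSemicontinuousOn C)
    obtain ⟨y, hy, hmax⟩ := husc.exists_isMaxOn hne hC
    refine ⟨_, ⟨y, hy, rfl⟩, ?_⟩
    rintro _ ⟨y', hy', rfl⟩
    exact hmax hy'
  choose s hs using key
  exact ⟨s, hs⟩

variable {C : Set E} {U s : E → ℝ} {c l : ℝ}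

lemma IsSupConv.exists_eq (h : IsSupConv C U c s) (z : E) :
    ∃ y ∈ C, s z = U y - c * ‖z - y‖ ^ 2 := by
  obtain ⟨y, hy, e⟩ := (h z).1
  exact ⟨y, hy, e.symm⟩

lemma IsSupConv.le (h : IsSupConv C U c s) (z : E) {y : E} (hy : y ∈ C) :
    U y - c * ‖z - y‖ ^ 2 ≤ s z :=
  (h z).2 ⟨y, hy, rfl⟩

variable [InnerProductSpace ℝ E]

lemma norm_lineMap_sub_sq (a b y : E) (t : ℝ) :
    ‖a + t • (b - a) - y‖ ^ 2 =
      (1 - t) * ‖a - y‖ ^ 2 + t * ‖b - y‖ ^ 2 - t * (1 - t) * ‖b - a‖ ^ 2 := by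
  have e1 : a + t • (b - a) - y = (a - y) + t • (b - a) := by abel
  have e2 : b - y = (a - y) + (b - a) := by abel
  rw [e1, e2, norm_add_sq_real, norm_add_sq_real, norm_smul, inner_smul_right, mul_pow,
    Real.norm_eq_abs, sq_abs]
  ring

lemma IsSupConv.segment (h : IsSupConv C U c s) (a b : E) {t : ℝ} (h0 : 0 ≤ t) (h1 : t ≤ 1) :
    s (a + t • (b - a)) ≤ (1 - t) * s a + t * s b + c * (t * (1 - t) * ‖b - a‖ ^ 2) := by
  obtain ⟨y, hy, e⟩ := h.exists_eq (a + t • (b - a))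
  rw [e, norm_lineMap_sub_sq]
  have ha := mul_le_mul_of_nonneg_left (h.le a hy) (sub_nonneg.2 h1)
  have hb := mul_le_mul_of_nonneg_left (h.le b hy) h0
  nlinarith

lemma IsSupConv.continuous [FiniteDimensional ℝ E] (h : IsSupConv C U c s) : Continuous s := by
  have hconv : ConvexOn ℝ Set.univ fun z => s z + c * ‖z‖ ^ 2 := by
    refine ⟨convex_univ, fun a _ b _ p q hp hq hpq => ?_⟩
    obtain rfl : p = 1 - q := by linarith
    have e : (1 - q) • a + q • b = a + q • (b - a) := by module
    have h1 := h.segment a b hq (by linarith)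
    have h2 := norm_lineMap_sub_sq a b 0 q
    simp only [sub_zero] at h2
    simp only [e, smul_eq_mul]
    rw [h2]
    linarith
  have hc := continuousOn_univ.1 (hconv.continuousOn isOpen_univ)
  have : s = fun z => (s z + c * ‖z‖ ^ 2) - c * ‖z‖ ^ 2 := by ext; ring
  rw [this]
  exact hc.sub (by fun_prop)

lemma IsSupConv.le_add (hl : 0 < l) (h : IsSupConv C U (l / 3) s) (x z : E) {y : E}
    (hy : y ∈ C) : U y - l / 2 * ‖x - y‖ ^ 2 ≤ s z + l * ‖x - z‖ ^ 2 := by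
  have h1 := h.le z hy
  have h2 := mul_nonneg hl.le (sq_nonneg ‖(3 : ℝ) • (x - z) - (y - z)‖)
  rw [norm_sub_sq_real, norm_smul, inner_smul_left] at h2
  have h3 : ‖x - y‖ ^ 2 = ‖(x - z) - (y - z)‖ ^ 2 := by congr 2; abel
  rw [norm_sub_sq_real (x - z)] at h3
  rw [norm_sub_rev z y] at h1
  simp only [Real.norm_ofNat, conj_trivial] at h2
  rw [h3]
  nlinarith

lemma IsSupConv.exists_prox [FiniteDimensional ℝ E] (hne : C.Nonempty) (hl : 0 < l)
    (h : IsSupConv C U (l / 3) s) (x : E) :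
    ∃ z₀, ∀ z, s z₀ + l * ‖x - z₀‖ ^ 2 + 2 * l / 3 * ‖z - z₀‖ ^ 2 ≤ s z + l * ‖x - z‖ ^ 2 := by
  obtain ⟨y₀, hy₀⟩ := hne
  have hcont : Continuous fun z => s z + l * ‖x - z‖ ^ 2 := h.continuous.add (by fun_prop)
  have hlim : Tendsto (fun z => s z + l * ‖x - z‖ ^ 2) (cocompact E) atTop := by
    have h1 : Tendsto (fun z : E => ‖z‖ - ‖x‖) (cocompact E) atTop :=
      tendsto_atTop_add_const_right _ _ (tendsto_norm_cocompact_atTop (E := E))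
    have h2 : Tendsto (fun z : E => ‖x - z‖) (cocompact E) atTop :=
      tendsto_atTop_mono (fun z => by rw [norm_sub_rev]; exact norm_sub_norm_le z x) h1
    have h3 : Tendsto (fun z : E => l / 3 * ‖x - z‖ ^ 2) (cocompact E) atTop :=
      ((tendsto_pow_atTop two_ne_zero).comp h2).const_mul_atTop (by positivity)
    refine tendsto_atTop_mono (fun z => ?_)
      (tendsto_atTop_add_const_left _ (U y₀ - 2 * l / 3 * ‖x - y₀‖ ^ 2) h3)
    have h4 := h.le z hy₀
    have h5 : ‖z - y₀‖ ^ 2 ≤ 2 * ‖x - z‖ ^ 2 + 2 * ‖x - y₀‖ ^ 2 := by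
      have := norm_sub_le (x - y₀) (x - z)
      rw [show x - y₀ - (x - z) = z - y₀ by abel] at this
      nlinarith [norm_nonneg (z - y₀), sq_nonneg (‖x - y₀‖ - ‖x - z‖)]
    nlinarith
  obtain ⟨z₀, hz₀⟩ := hcont.exists_forall_le hlim
  refine ⟨z₀, fun z => ?_⟩
  have key : ∀ t : ℝ, t ∈ Set.Ioo (0 : ℝ) 1 →
      s z₀ + l * ‖x - z₀‖ ^ 2 + 2 * l / 3 * ‖z - z₀‖ ^ 2 - t * (2 * l / 3 * ‖z - z₀‖ ^ 2) ≤
        s z + l * ‖x - z‖ ^ 2 := by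
    rintro t ⟨ht0, ht1⟩
    have h1 := hz₀ (z₀ + t • (z - z₀))
    have h2 := h.segment z₀ z ht0.le ht1.le
    have h3 := norm_lineMap_sub_sq z₀ z x t
    simp only [norm_sub_rev x] at h1 ⊢
    rw [h3] at h1
    refine le_of_mul_le_mul_left ?_ ht0
    nlinarith
  have hlim2 : Tendsto (fun t : ℝ => s z₀ + l * ‖x - z₀‖ ^ 2 + 2 * l / 3 * ‖z - z₀‖ ^ 2 -
      t * (2 * l / 3 * ‖z - z₀‖ ^ 2)) (𝓝[>] 0)
      (𝓝 (s z₀ + l * ‖x - z₀‖ ^ 2 + 2 * l / 3 * ‖z - z₀‖ ^ 2 -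
      0 * (2 * l / 3 * ‖z - z₀‖ ^ 2))) :=
    ((by fun_prop : Continuous fun t : ℝ => s z₀ + l * ‖x - z₀‖ ^ 2 +
      2 * l / 3 * ‖z - z₀‖ ^ 2 - t * (2 * l / 3 * ‖z - z₀‖ ^ 2)).tendsto 0).mono_left
      nhdsWithin_le_nhds
  have := le_of_tendsto hlim2 (eventually_of_mem (Ioo_mem_nhdsGT one_pos) key)
  simpa using this

/-- The properties of a double (sup then inf) convolution `a` of `U` with gradient `G`: it is
`C^{1,1}`, `l`-semiconvex, dominates the sup-convolution of `U`, and agrees with it at every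
point where it is touched from above by a paraboloid of opening `l`. -/
structure IsRegularization (C : Set E) (U : E → ℝ) (l : ℝ) (a : E → ℝ) (G : E → E) : Prop where
  le : ∀ x, ∀ y ∈ C, U y - l / 2 * ‖x - y‖ ^ 2 ≤ a x
  lipschitz : LipschitzWith (Real.toNNReal (5 * l)) G
  upper : ∀ x t, a t ≤ a x + inner ℝ (G x) (t - x) + l * ‖t - x‖ ^ 2
  lower : ∀ x t, a x + inner ℝ (G x) (t - x) - l / 2 * ‖t - x‖ ^ 2 ≤ a t
  contact : ∀ x, (∀ t, a t ≤ a x + inner ℝ (G x) (t - x) + l / 2 * ‖t - x‖ ^ 2) →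
    ∃ y ∈ C, a x = U y - l / 2 * ‖x - y‖ ^ 2
  decay : ∀ x, ∃ y ∈ C, a x ≤ U y - l / 3 * ‖x - y‖ ^ 2

lemma exists_isRegularization [FiniteDimensional ℝ E] (hC : IsCompact C) (hne : C.Nonempty)
    (hU : UpperSemicontinuousOn U C) (hl : 0 < l) : ∃ a G, IsRegularization C U l a G := by
  obtain ⟨s, hs⟩ := exists_isSupConv hC hne hU (l / 3)
  choose Z hZ using hs.exists_prox hne hl
  refine ⟨fun x => s (Z x) + l * ‖x - Z x‖ ^ 2, fun x => (2 * l) • (x - Z x), ?_, ?_, ?_, ?_, ?_, ?_⟩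
  · exact fun x y hy => hs.le_add hl x (Z x) hy
  · refine LipschitzWith.of_dist_le_mul fun x x' => ?_
    have h1 := hZ x (Z x')
    have h2 := hZ x' (Z x)
    rw [norm_sub_rev (Z x) (Z x')] at h2
    have e1 : x - Z x' = (x - Z x) - (Z x' - Z x) := by abel
    have e2 : x' - Z x = (x' - Z x') + (Z x' - Z x) := by abel
    rw [e1, norm_sub_sq_real (x - Z x)] at h1
    rw [e2, norm_add_sq_real (x' - Z x')] at h2
    have h3 : 2 / 3 * ‖Z x' - Z x‖ ^ 2 ≤ inner ℝ (x' - x) (Z x' - Z x) := by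
      have e3 : x' - x = (x' - Z x') - (x - Z x) + (Z x' - Z x) := by abel
      rw [e3, inner_add_left, inner_sub_left, real_inner_self_eq_norm_sq]
      refine le_of_mul_le_mul_left ?_ hl
      nlinarith
    have h4 : 2 / 3 * ‖Z x' - Z x‖ ≤ ‖x' - x‖ := by
      have h5 := h3.trans (real_inner_le_norm _ _)
      rcases (norm_nonneg (Z x' - Z x)).eq_or_lt with h6 | h6
      · rw [← h6]; simp
      · refine le_of_mul_le_mul_right ?_ h6
        nlinarith
    rw [dist_eq_norm, dist_eq_norm, ← smul_sub, norm_smul, Real.coe_toNNReal _ (by positivity),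
      Real.norm_of_nonneg (by positivity)]
    have h7 : ‖x - Z x - (x' - Z x')‖ ≤ ‖x - x'‖ + ‖Z x' - Z x‖ := by
      rw [show x - Z x - (x' - Z x') = (x - x') + (Z x' - Z x) by abel]
      exact norm_add_le _ _
    rw [norm_sub_rev x' x] at h4
    nlinarith
  · intro x t
    have h1 := hZ t (Z x)
    have e1 : t - Z x = (x - Z x) + (t - x) := by abel
    rw [e1, norm_add_sq_real (x - Z x)] at h1
    rw [inner_smul_left]
    simp only [conj_trivial]
    have : 0 ≤ 2 * l / 3 * ‖Z x - Z t‖ ^ 2 := by positivity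
    nlinarith
  · intro x t
    have h1 := hZ x (Z t)
    have e1 : t - Z t = (x - Z x) + (t - x) - (Z t - Z x) := by abel
    have e2 : x - Z t = (x - Z x) - (Z t - Z x) := by abel
    rw [e1, norm_sub_sq_real (x - Z x + (t - x)), norm_add_sq_real (x - Z x),
      inner_add_left, inner_smul_left]
    rw [e2, norm_sub_sq_real (x - Z x)] at h1
    simp only [conj_trivial]
    have h2 := mul_nonneg hl.le (sq_nonneg ‖(3 : ℝ) • (t - x) - (2 : ℝ) • (Z t - Z x)‖)
    rw [norm_sub_sq_real, norm_smul, norm_smul, inner_smul_left, inner_smul_right] at h2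
    simp only [Real.norm_ofNat, conj_trivial] at h2
    nlinarith
  · intro x hx
    obtain ⟨y, hy, e⟩ := hs.exists_eq (Z x)
    refine ⟨y, hy, ?_⟩
    -- `k` measures the failure of `x`, `Z x`, `y` to be in the optimal position.
    set k := (3 : ℝ) • (x - Z x) - (y - Z x) with hk
    have hk0 : ‖k‖ ^ 2 ≤ 0 := by
      have h1 := (hs.le_add hl (x + (-(1 / 2 : ℝ)) • k) _ hy).trans (hx (x + (-(1 / 2 : ℝ)) • k))
      have e1 : x + (-(1 / 2 : ℝ)) • k - y = (1 / 2 : ℝ) • k - (2 : ℝ) • (x - Z x) := by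
        rw [hk]; module
      have e2 : Z x - y = k - (3 : ℝ) • (x - Z x) := by rw [hk]; module
      rw [e, e1, e2, add_sub_cancel_left, norm_sub_sq_real ((1 / 2 : ℝ) • k), norm_sub_sq_real k,
        norm_smul, norm_smul, norm_smul, norm_smul, inner_smul_left, inner_smul_left,
        inner_smul_right, inner_smul_right, inner_smul_right, real_inner_comm k] at h1
      norm_num at h1
      refine le_of_mul_le_mul_left ?_ hl
      nlinarith
    have hk1 : k = 0 := by simpa using le_antisymm hk0 (sq_nonneg _)
    have e1 : y = Z x + (3 : ℝ) • (x - Z x) := by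
      rw [hk] at hk1; rw [sub_eq_zero.1 hk1]; abel
    have e2 : Z x - y = (-3 : ℝ) • (x - Z x) := by rw [e1]; module
    have e3 : x - y = (-2 : ℝ) • (x - Z x) := by
      rw [e1]; module
    rw [e, e2, e3, norm_smul, norm_smul]
    norm_num
    ring
  · intro x
    obtain ⟨y, hy, e⟩ := hs.exists_eq x
    refine ⟨y, hy, ?_⟩
    have := hZ x x
    rw [← e]
    simp only [sub_self, norm_zero] at this
    have : 0 ≤ 2 * l / 3 * ‖x - Z x‖ ^ 2 := by positivity
    nlinarith

end Regularization

section SumTheorem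

variable {E : Type*} [NormedAddCommGroup E]

lemma exists_penalty_localizing {C V : Set E} (hC : IsCompact C) (hV : IsOpen V)
    {U W : E → ℝ} (hU : UpperSemicontinuousOn U C) (hW : UpperSemicontinuousOn W C) {m : ℝ}
    (hm : ∀ y ∈ C \ V, U y + W y < m) :
    ∃ l > 0, ∀ y ∈ C, ∀ z ∈ C, m ≤ U y + W z - l / 4 * ‖y - z‖ ^ 2 → y ∈ V ∧ z ∈ V := by
  obtain ⟨BU, hBU⟩ := hU.bddAbove_of_isCompact hC
  obtain ⟨BW, hBW⟩ := hW.bddAbove_of_isCompact hC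
  set K : Set (E × E) := (C ×ˢ C) ∩ (V ×ˢ V)ᶜ with hK
  have hKc : IsCompact K := (hC.prod hC).inter_right (hV.prod hV).isClosed_compl
  have hg : UpperSemicontinuousOn (fun q : E × E => U q.1 + W q.2) K := by
    refine UpperSemicontinuousOn.add (fun q hq y hy => ?_) (fun q hq y hy => ?_)
    · have hq1 : Tendsto Prod.fst (𝓝[K] q) (𝓝[C] q.1) :=
        tendsto_nhdsWithin_of_tendsto_nhds_of_eventually_within _
          (continuous_fst.continuousAt.tendsto.mono_left nhdsWithin_le_nhds)
          (eventually_of_mem self_mem_nhdsWithin fun r hr => hr.1.1)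
      exact hq1.eventually (hU q.1 hq.1.1 y hy)
    · have hq1 : Tendsto Prod.snd (𝓝[K] q) (𝓝[C] q.2) :=
        tendsto_nhdsWithin_of_tendsto_nhds_of_eventually_within _
          (continuous_snd.continuousAt.tendsto.mono_left nhdsWithin_le_nhds)
          (eventually_of_mem self_mem_nhdsWithin fun r hr => hr.1.2)
      exact hq1.eventually (hW q.2 hq.1.2 y hy)
  have hK' : IsCompact (K ∩ (fun q : E × E => U q.1 + W q.2) ⁻¹' Set.Ici m) :=
    hg.isCompact_inter_preimage_Ici hKc m
  set K' := K ∩ (fun q : E × E => U q.1 + W q.2) ⁻¹' Set.Ici m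
  rcases K'.eq_empty_or_nonempty with hemp | hne
  · refine ⟨1, one_pos, fun y hy z hz h => ?_⟩
    by_contra hcon
    have : (y, z) ∈ K' := ⟨⟨⟨hy, hz⟩, hcon⟩, by
      change m ≤ U y + W z
      nlinarith [sq_nonneg ‖y - z‖]⟩
    rw [hemp] at this
    exact this
  · obtain ⟨q, hq, hmin⟩ := hK'.exists_isMinOn hne
      (f := fun q : E × E => ‖q.1 - q.2‖ ^ 2) (by fun_prop)
    have hpos : 0 < ‖q.1 - q.2‖ ^ 2 := by
      rcases (sq_nonneg ‖q.1 - q.2‖).eq_or_lt with h0 | h0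
      · exfalso
        have heq : q.1 = q.2 := by
          rw [← sub_eq_zero, ← norm_eq_zero]
          exact pow_eq_zero_iff two_ne_zero |>.1 h0.symm
        have h1 : q.1 ∉ V := fun h => hq.1.2 ⟨h, heq ▸ h⟩
        have h2 := hm q.1 ⟨hq.1.1.1, h1⟩
        have h3 : m ≤ U q.1 + W q.2 := hq.2
        rw [← heq] at h3
        linarith
      · exact h0
    set d := ‖q.1 - q.2‖ ^ 2
    refine ⟨4 * (|BU + BW - m| + 1) / d, by positivity, fun y hy z hz h => ?_⟩
    by_contra hcon
    have hl : 0 ≤ 4 * (|BU + BW - m| + 1) / d := by positivity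
    have hyz : (y, z) ∈ K' := ⟨⟨⟨hy, hz⟩, hcon⟩, by
      change m ≤ U y + W z
      nlinarith [sq_nonneg ‖y - z‖]⟩
    have h1 : d ≤ ‖y - z‖ ^ 2 := hmin hyz
    have h2 : 4 * (|BU + BW - m| + 1) / d / 4 * d = |BU + BW - m| + 1 := by field_simp
    have h3 := hBU ⟨y, hy, rfl⟩
    have h4 := hBW ⟨z, hz, rfl⟩
    have h5 := mul_le_mul_of_nonneg_left h1 (div_nonneg hl (by norm_num : (0 : ℝ) ≤ 4))
    have h6 := le_abs_self (BU + BW - m)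
    linarith

variable [InnerProductSpace ℝ E]

lemma IsRegularization.hasFDerivAt {C : Set E} {U a : E → ℝ} {G : E → E} {l : ℝ} (hl : 0 < l)
    (h : IsRegularization C U l a G) (x : E) : HasFDerivAt a (innerSL ℝ (G x)) x := by
  have hO : (fun t => a t - a x - innerSL ℝ (G x) (t - x)) =O[𝓝 x] fun t => ‖t - x‖ ^ 2 := by
    refine Asymptotics.IsBigO.of_bound l (Eventually.of_forall fun t => ?_)
    have h1 := h.upper x t
    have h2 := h.lower x t
    have h3 : 0 ≤ l / 2 * ‖t - x‖ ^ 2 := by positivity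
    rw [Real.norm_eq_abs, Real.norm_eq_abs, abs_of_nonneg (sq_nonneg ‖t - x‖), abs_le,
      innerSL_apply_apply]
    constructor <;> linarith
  refine HasFDerivAt.of_isLittleO (hO.trans_isLittleO ?_)
  exact Asymptotics.isLittleO_pow_sub_sub x one_lt_two

lemma eventually_abs_taylor_two_le_s5 {a : E → ℝ} {G : E → E} {A : E →L[ℝ] E} {x : E}
    (ha : ∀ y, HasFDerivAt a (innerSL ℝ (G y)) y) (hA : HasFDerivAt G A x) {η : ℝ} (hη : 0 < η) :
    ∀ᶠ h in 𝓝 (0 : E),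
      |a (x + h) - a x - inner ℝ (G x) h - 1 / 2 * inner ℝ (A h) h| ≤ η * ‖h‖ ^ 2 := by
  have h1 := (hasFDerivAt_iff_isLittleO_nhds_zero.1 hA).def hη
  obtain ⟨r, hr, hball⟩ := Metric.eventually_nhds_iff_ball.1 h1
  filter_upwards [Metric.ball_mem_nhds (0 : E) hr] with h hh
  have hder : ∀ t ∈ Set.Icc (0 : ℝ) 1,
      HasDerivWithinAt (fun t : ℝ => a (x + t • h) - t * inner ℝ (G x) h -
        1 / 2 * t ^ 2 * inner ℝ (A h) h)
        (inner ℝ (G (x + t • h) - G x - A (t • h)) h) (Set.Icc 0 1) t := by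
    intro t _
    have e1 : HasDerivAt (fun t : ℝ => x + t • h) h t := by
      simpa using ((hasDerivAt_id t).smul_const h).const_add x
    have e2 := (ha (x + t • h)).comp_hasDerivAt t e1
    have e3 := (e2.sub ((hasDerivAt_id t).mul_const (inner ℝ (G x) h))).sub
      ((((hasDerivAt_id t).pow 2).const_mul (1 / 2)).mul_const (inner ℝ (A h) h))
    refine (e3.congr_deriv ?_).hasDerivWithinAt
    simp [inner_sub_left, inner_smul_left]
  have hbound : ∀ t ∈ Set.Ico (0 : ℝ) 1,
      ‖inner ℝ (G (x + t • h) - G x - A (t • h)) h‖ ≤ η * ‖h‖ ^ 2 := by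
    rintro t ⟨ht0, ht1⟩
    have e1 : ‖t • h‖ ≤ ‖h‖ := by
      rw [norm_smul, Real.norm_of_nonneg ht0]
      exact mul_le_of_le_one_left (norm_nonneg h) ht1.le
    have e2 : t • h ∈ Metric.ball (0 : E) r := by
      rw [mem_ball_zero_iff] at hh ⊢
      exact e1.trans_lt hh
    calc _ ≤ ‖G (x + t • h) - G x - A (t • h)‖ * ‖h‖ := norm_inner_le_norm _ _
      _ ≤ η * ‖t • h‖ * ‖h‖ := by gcongr; exact hball _ e2
      _ ≤ η * ‖h‖ * ‖h‖ := by gcongr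
      _ = _ := by ring
  have := norm_image_sub_le_of_norm_deriv_le_segment_01' hder hbound
  rw [Real.norm_eq_abs] at this
  convert this using 2
  simp
  ring

open MeasureTheory in
lemma exists_slope_forall_differentiableAt [FiniteDimensional ℝ E] {G H : E → E} {K L : NNReal}
    (hG : LipschitzWith K G) (hH : LipschitzWith L H) {ρ : ℝ} (hρ : 0 < ρ) :
    ∃ p : E, ‖p‖ < ρ ∧ ∀ x, G x + H x = p → DifferentiableAt ℝ G x ∧ DifferentiableAt ℝ H x := by
  let : MeasurableSpace E := borel E
  have : BorelSpace E := ⟨rfl⟩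
  set μ : Measure E := Measure.hausdorffMeasure (Module.finrank ℝ E)
  set N := {x | ¬(DifferentiableAt ℝ G x ∧ DifferentiableAt ℝ H x)} with hN
  have h1 : μ N = 0 := by
    have := (hG.ae_differentiableAt (μ := μ)).and (hH.ae_differentiableAt (μ := μ))
    exact this
  have h2 : μ ((fun x => G x + H x) '' N) = 0 := by
    have := (hG.add hH).hausdorffMeasure_image_le (d := Module.finrank ℝ E) (by positivity) N
    refine le_antisymm (this.trans ?_) zero_le
    change _ * μ N ≤ 0
    rw [h1, mul_zero]
  have h3 : 0 < μ (Metric.ball (0 : E) ρ) := Metric.measure_ball_pos μ 0 hρ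
  have h4 : ¬ Metric.ball (0 : E) ρ ⊆ (fun x => G x + H x) '' N := fun hsub =>
    h3.ne' (measure_mono_null hsub h2)
  obtain ⟨p, hp, hpN⟩ := Set.not_subset.1 h4
  refine ⟨p, by simpa using hp, fun x hx => ?_⟩
  by_contra hcon
  exact hpN ⟨x, hcon, hx⟩

lemma exists_linear_perturbation_max {Φ : E → ℝ} [FiniteDimensional ℝ E] (hΦ : Continuous Φ)
    {c D M m' : ℝ} (hc : 0 < c) (hD : ∀ x, Φ x ≤ D - c * ‖x‖ ^ 2) (hm : m' < M) {x₀ : E}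
    (hx₀ : M ≤ Φ x₀) :
    ∃ ρ > 0, ∀ p : E, ‖p‖ < ρ →
      ∃ x, m' ≤ Φ x ∧ ∀ t, Φ t - inner ℝ p t ≤ Φ x - inner ℝ p x := by
  set K := |D - M + ‖x₀‖| with hK
  set R := 1 + (1 + K) / c + ‖x₀‖ with hR
  have hK0 : 0 ≤ K := abs_nonneg _
  have hR0 : 0 < R := by positivity
  refine ⟨min 1 ((M - m') / (R + R)), lt_min one_pos (div_pos (by linarith) (by linarith)),
    fun p hp => ?_⟩
  have hp1 : ‖p‖ ≤ 1 := (hp.trans_le (min_le_left _ _)).le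
  have hp2 : ‖p‖ * (R + R) ≤ M - m' :=
    (le_div_iff₀ (by linarith)).1 (hp.trans_le (min_le_right _ _)).le
  have hinner : ∀ t, |inner ℝ p t| ≤ ‖p‖ * ‖t‖ := fun t => abs_real_inner_le_norm p t
  have hx₀R : x₀ ∈ Metric.closedBall (0 : E) R := by
    rw [mem_closedBall_zero_iff, hR]
    have : 0 ≤ (1 + K) / c := by positivity
    linarith
  obtain ⟨x, hxR, hmax⟩ := (isCompact_closedBall (0 : E) R).exists_isMaxOn ⟨x₀, hx₀R⟩
    (f := fun t => Φ t - inner ℝ p t) (by fun_prop)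
  rw [mem_closedBall_zero_iff] at hx₀R hxR
  have hx0 : Φ x₀ - inner ℝ p x₀ ≤ Φ x - inner ℝ p x := hmax (by simpa using hx₀R)
  have e0 := abs_le.1 (hinner x₀)
  refine ⟨x, ?_, fun t => ?_⟩
  · have e1 := abs_le.1 (hinner x)
    have e2 : ‖p‖ * ‖x₀‖ ≤ ‖p‖ * R := by gcongr
    have e3 : ‖p‖ * ‖x‖ ≤ ‖p‖ * R := by gcongr
    linarith
  · by_cases ht : ‖t‖ ≤ R
    · exact hmax (by simpa using ht)
    · push Not at ht
      refine le_trans ?_ hx0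
      have e1 := abs_le.1 (hinner t)
      have e2 : ‖p‖ * ‖t‖ ≤ ‖t‖ := mul_le_of_le_one_left (norm_nonneg t) hp1
      have e3 : ‖p‖ * ‖x₀‖ ≤ ‖x₀‖ := mul_le_of_le_one_left (norm_nonneg _) hp1
      have e4 : 1 + K ≤ c * ‖t‖ := by
        rw [← div_le_iff₀' hc]
        linarith [norm_nonneg x₀]
      have e5 : 1 ≤ ‖t‖ := by
        have : 0 ≤ (1 + K) / c := by positivity
        linarith [norm_nonneg x₀]
      have e6 := hD t
      have e7 := le_abs_self (D - M + ‖x₀‖)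
      have e8 : (1 + K) * ‖t‖ ≤ c * ‖t‖ * ‖t‖ := by gcongr
      have e9 : K ≤ K * ‖t‖ := le_mul_of_one_le_right hK0 e5
      nlinarith

lemma inner_add_inner_nonpos_of_max {a b : E → ℝ} {G H : E → E} {A B : E →L[ℝ] E} {x p : E}
    (ha : ∀ y, HasFDerivAt a (innerSL ℝ (G y)) y) (hA : HasFDerivAt G A x)
    (hb : ∀ y, HasFDerivAt b (innerSL ℝ (H y)) y) (hB : HasFDerivAt H B x) (hp : G x + H x = p)
    (hmax : ∀ t, a t + b t - inner ℝ p t ≤ a x + b x - inner ℝ p x) (h : E) :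
    inner ℝ (A h) h + inner ℝ (B h) h ≤ 0 := by
  by_contra! hcon
  set q := inner ℝ (A h) h + inner ℝ (B h) h with hq
  set η := q / (8 * (‖h‖ ^ 2 + 1)) with hη
  have hη0 : 0 < η := by positivity
  have htend : Tendsto (fun t : ℝ => t • h) (𝓝[>] 0) (𝓝 0) := by
    have : Continuous fun t : ℝ => t • h := by fun_prop
    simpa using (this.tendsto 0).mono_left nhdsWithin_le_nhds
  obtain ⟨t, h1, h2, ht⟩ := ((htend.eventually (eventually_abs_taylor_two_le_s5 ha hA hη0)).and
    ((htend.eventually (eventually_abs_taylor_two_le_s5 hb hB hη0)).and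
      self_mem_nhdsWithin)).exists
  have ht : 0 < t := ht
  have h3 := hmax (x + t • h)
  rw [← hp] at h3
  simp only [inner_add_left, inner_add_right, map_smul, inner_smul_left, inner_smul_right,
    norm_smul, conj_trivial, mul_pow, Real.norm_eq_abs, sq_abs] at h1 h2 h3
  have h4 := (abs_le.1 h1).1
  have h5 := (abs_le.1 h2).1
  have h6 : 0 < t ^ 2 := by positivity
  have h7 : t ^ 2 * q ≤ t ^ 2 * (4 * η * ‖h‖ ^ 2) := by
    rw [hq]; nlinarith
  have h8 := le_of_mul_le_mul_left h7 h6
  have h9 : 8 * η * (‖h‖ ^ 2 + 1) = q := by rw [hη]; field_simp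
  nlinarith [sq_nonneg ‖h‖]

theorem exists_quadratic_tests_of_interior_max [FiniteDimensional ℝ E] {C V : Set E}
    (hC : IsCompact C) (hV : IsOpen V) {U W : E → ℝ}
    (hU : UpperSemicontinuousOn U C) (hW : UpperSemicontinuousOn W C) {m M : ℝ} (hmM : m < M)
    (hm : ∀ y ∈ C \ V, U y + W y ≤ m) {x₀ : E} (hx₀ : x₀ ∈ C) (hM : M ≤ U x₀ + W x₀)
    {η : ℝ} (hη : 0 < η) :
    ∃ y ∈ V, ∃ z ∈ V, y ∈ C ∧ z ∈ C ∧ m < U y + W z ∧ ∃ (p q : E) (A B : E →L[ℝ] E),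
      (∀ᶠ h in 𝓝 (0 : E), y + h ∈ C →
        U (y + h) ≤ U y + inner ℝ p h + 1 / 2 * inner ℝ (A h) h + η * ‖h‖ ^ 2) ∧
      (∀ᶠ h in 𝓝 (0 : E), z + h ∈ C →
        W (z + h) ≤ W z + inner ℝ q h + 1 / 2 * inner ℝ (B h) h + η * ‖h‖ ^ 2) ∧
      ∀ h, inner ℝ (A h) h + inner ℝ (B h) h ≤ 0 := by
  obtain ⟨m', hmm', hm'M⟩ := exists_between hmM
  obtain ⟨l, hl, hloc⟩ := exists_penalty_localizing hC hV hU hW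
    (fun y hy => (hm y hy).trans_lt hmm')
  obtain ⟨a, G, ha⟩ := exists_isRegularization hC ⟨x₀, hx₀⟩ hU hl
  obtain ⟨b, H, hb⟩ := exists_isRegularization hC ⟨x₀, hx₀⟩ hW hl
  have hda := ha.hasFDerivAt hl
  have hdb := hb.hasFDerivAt hl
  obtain ⟨BU, hBU⟩ := hU.bddAbove_of_isCompact hC
  obtain ⟨BW, hBW⟩ := hW.bddAbove_of_isCompact hC
  obtain ⟨R, hR⟩ := hC.isBounded.exists_norm_le
  have hdec : ∀ x, ∀ y ∈ C, ‖x‖ ^ 2 / 2 - R ^ 2 ≤ ‖x - y‖ ^ 2 := by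
    intro x y hy
    have h1 := norm_sub_norm_le x y
    have h2 := hR y hy
    nlinarith [norm_nonneg (x - y), norm_nonneg x, norm_nonneg y,
      sq_nonneg (‖x - y‖ - ‖y‖), sq_nonneg (‖x - y‖ - R)]
  have hD : ∀ x, a x + b x ≤ BU + BW + 2 * l / 3 * R ^ 2 - l / 3 * ‖x‖ ^ 2 := by
    intro x
    obtain ⟨y, hy, h1⟩ := ha.decay x
    obtain ⟨z, hz, h2⟩ := hb.decay x
    have h3 := hBU ⟨y, hy, rfl⟩
    have h4 := hBW ⟨z, hz, rfl⟩
    have h5 := mul_le_mul_of_nonneg_left (hdec x y hy) (by positivity : 0 ≤ l / 3)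
    have h6 := mul_le_mul_of_nonneg_left (hdec x z hz) (by positivity : 0 ≤ l / 3)
    linarith
  have hcont : Continuous fun x => a x + b x :=
    continuous_iff_continuousAt.2 fun x => (hda x).continuousAt.add (hdb x).continuousAt
  have hM' : M ≤ a x₀ + b x₀ := by
    have h1 := ha.le x₀ x₀ hx₀
    have h2 := hb.le x₀ x₀ hx₀
    simp only [sub_self, norm_zero] at h1 h2
    linarith
  obtain ⟨ρ, hρ, hpert⟩ := exists_linear_perturbation_max hcont (by positivity) hD hm'M hM'
  obtain ⟨p, hpρ, hdiff⟩ := exists_slope_forall_differentiableAt ha.lipschitz hb.lipschitz hρ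
  obtain ⟨x, hxm, hmax⟩ := hpert p hpρ
  have hp : G x + H x = p := by
    have h1 : IsLocalMax (fun t => a t + b t - innerSL ℝ p t) x := Eventually.of_forall hmax
    have h2 := h1.hasFDerivAt_eq_zero
      (((hda x).add (hdb x)).sub (innerSL ℝ p).hasFDerivAt)
    have h3 : innerSL ℝ (G x + H x - p) = 0 := by rw [← h2]; simp
    have h4 := congrArg (fun f => f (G x + H x - p)) h3
    simp only [innerSL_apply_apply, zero_apply, inner_self_eq_zero] at h4
    exact sub_eq_zero.1 h4
  obtain ⟨hGx, hHx⟩ := hdiff x hp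
  obtain ⟨y, hy, hay⟩ := ha.contact x fun t => by
    have h1 := hmax t
    have h2 := hb.lower x t
    rw [← hp] at h1
    simp only [inner_add_left, inner_sub_right] at h1 h2 ⊢
    linarith
  obtain ⟨z, hz, hbz⟩ := hb.contact x fun t => by
    have h1 := hmax t
    have h2 := ha.lower x t
    rw [← hp] at h1
    simp only [inner_add_left, inner_sub_right] at h1 h2 ⊢
    linarith
  have hyz : ‖y - z‖ ^ 2 ≤ 2 * ‖x - y‖ ^ 2 + 2 * ‖x - z‖ ^ 2 := by
    have := norm_sub_le (x - z) (x - y)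
    rw [show x - z - (x - y) = y - z by abel] at this
    nlinarith [norm_nonneg (y - z), sq_nonneg (‖x - z‖ - ‖x - y‖)]
  obtain ⟨hyV, hzV⟩ := hloc y hy z hz (by nlinarith)
  have hgt : m < U y + W z := by
    have : 0 ≤ l / 2 * ‖x - y‖ ^ 2 := by positivity
    have : 0 ≤ l / 2 * ‖x - z‖ ^ 2 := by positivity
    linarith
  refine ⟨y, hyV, z, hzV, hy, hz, hgt, G x, H x, fderiv ℝ G x, fderiv ℝ H x, ?_, ?_,
    inner_add_inner_nonpos_of_max hda hGx.hasFDerivAt hdb hHx.hasFDerivAt hp hmax⟩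
  · filter_upwards [eventually_abs_taylor_two_le_s5 hda hGx.hasFDerivAt hη] with h hh hmem
    have h1 := ha.le (x + h) _ hmem
    rw [add_sub_add_right_eq_sub] at h1
    have h2 := (abs_le.1 hh).2
    linarith
  · filter_upwards [eventually_abs_taylor_two_le_s5 hdb hHx.hasFDerivAt hη] with h hh hmem
    have h1 := hb.le (x + h) _ hmem
    rw [add_sub_add_right_eq_sub] at h1
    have h2 := (abs_le.1 hh).2
    linarith

end SumTheorem

section Comparison

lemma contDiff_quadratic_s5 {E : Type*} [NormedAddCommGroup E] [InnerProductSpace ℝ E]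
    (y p : E) (c : ℝ) (T : E →L[ℝ] E) :
    ContDiff ℝ 2 fun t => c + inner ℝ p (t - y) + 1 / 2 * inner ℝ (T (t - y)) (t - y) := by
  have h : ContDiff ℝ 2 fun t : E => t - y := contDiff_id.sub contDiff_const
  exact (contDiff_const.add (contDiff_const.inner ℝ h)).add
    (contDiff_const.mul ((T.contDiff.comp h).inner ℝ h))

lemma hessMatrix_quadratic_apply (y p : EucSp n) (c : ℝ) (T : EucSp n →L[ℝ] EucSp n)
    (i j : Fin n) :
    hessMatrix (fun t => c + inner ℝ p (t - y) + 1 / 2 * inner ℝ (T (t - y)) (t - y)) y i j =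
      1 / 2 * (inner ℝ (T (EuclideanSpace.single i 1)) (EuclideanSpace.single j 1) +
        inner ℝ (T (EuclideanSpace.single j 1)) (EuclideanSpace.single i 1)) := by
  set ψ : EucSp n → ℝ :=
    fun t => c + inner ℝ p (t - y) + 1 / 2 * inner ℝ (T (t - y)) (t - y) with hψ
  have hsm : ContDiff ℝ 2 ψ := contDiff_quadratic_s5 y p c T
  have h1 : ∀ t k, fderiv ℝ ψ t k =
      inner ℝ p k + 1 / 2 * (inner ℝ (T (t - y)) k + inner ℝ (T k) (t - y)) := by
    intro t k
    have e1 : HasFDerivAt (fun t : EucSp n => t - y) (ContinuousLinearMap.id ℝ (EucSp n)) t :=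
      (hasFDerivAt_id t).sub_const y
    have e2 := T.hasFDerivAt.comp t e1
    have e3 := (((innerSL ℝ p).hasFDerivAt.comp t e1).const_add c).add
      ((e2.inner ℝ e1).const_mul (1 / 2))
    have e4 : HasFDerivAt ψ _ t := e3
    rw [e4.fderiv]
    simp
  have h2 : DifferentiableAt ℝ (fderiv ℝ ψ) y :=
    (hsm.fderiv_right (m := 1) (by norm_num)).differentiable (by norm_num) y
  simp only [hessMatrix, Matrix.of_apply, iteratedFDeriv_two_apply, Matrix.cons_val_zero,
    Matrix.cons_val_one]
  set ei : EucSp n := EuclideanSpace.single i 1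
  set ej : EucSp n := EuclideanSpace.single j 1
  have h3 : fderiv ℝ (fderiv ℝ ψ) y ei ej = fderiv ℝ (fun t => fderiv ℝ ψ t ej) y ei := by
    rw [fderiv_clm_apply h2 (differentiableAt_const ej)]
    simp
  rw [h3]
  have e1 : HasFDerivAt (fun t : EucSp n => t - y) (ContinuousLinearMap.id ℝ (EucSp n)) y :=
    (hasFDerivAt_id y).sub_const y
  have e2 := T.hasFDerivAt.comp y e1
  have e3 := ((e2.inner ℝ (hasFDerivAt_const ej y)).add
    ((innerSL ℝ (T ej)).hasFDerivAt.comp y e1)).const_mul (1 / 2)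
  have e4 : HasFDerivAt (fun t => fderiv ℝ ψ t ej) _ y :=
    (e3.const_add (inner ℝ p ej)).congr_of_eventuallyEq (Eventually.of_forall fun t => h1 t ej)
  rw [e4.fderiv]
  simp
  ring

/-- The symmetric part of a linear map, as a symmetric matrix. -/
def symPart (T : EucSp n →L[ℝ] EucSp n) : SymMat n :=
  ⟨Matrix.of fun i j => 1 / 2 *
    (inner ℝ (T (EuclideanSpace.single i 1)) (EuclideanSpace.single j 1) +
      inner ℝ (T (EuclideanSpace.single j 1)) (EuclideanSpace.single i 1)), by
    rw [selfAdjoint.mem_iff]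
    ext i j
    simp [Matrix.star_apply, add_comm]⟩

lemma symPart_val_eq_hessMatrix (y p : EucSp n) (c : ℝ) (T : EucSp n →L[ℝ] EucSp n) :
    (symPart T : Matrix (Fin n) (Fin n) ℝ) =
      hessMatrix (fun t => c + inner ℝ p (t - y) + 1 / 2 * inner ℝ (T (t - y)) (t - y)) y := by
  ext i j
  rw [hessMatrix_quadratic_apply]
  rfl

lemma symPart_posSemidef {T : EucSp n →L[ℝ] EucSp n} (hT : ∀ h, 0 ≤ inner ℝ (T h) h) :
    (symPart T : Matrix (Fin n) (Fin n) ℝ).PosSemidef := by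
  refine Matrix.PosSemidef.of_dotProduct_mulVec_nonneg (symPart T).2 fun v => ?_
  have hv := hT (∑ i, v i • EuclideanSpace.single i (1 : ℝ))
  refine hv.trans_eq ?_
  have e : ∀ f : Fin n → Fin n → ℝ, ∑ i, ∑ j, v i * (v j * f i j) =
      ∑ i, ∑ j, v i * (1 / 2 * (f i j + f j i) * v j) := by
    intro f
    have e1 : ∑ i, ∑ j, v i * (v j * f i j) = ∑ i, ∑ j, v i * (v j * f j i) := by
      rw [Finset.sum_comm]
      refine Finset.sum_congr rfl fun i _ => Finset.sum_congr rfl fun j _ => by ring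
    have e2 : ∑ i, ∑ j, v i * (1 / 2 * (f i j + f j i) * v j) =
        1 / 2 * (∑ i, ∑ j, v i * (v j * f i j)) + 1 / 2 * ∑ i, ∑ j, v i * (v j * f j i) := by
      simp only [Finset.mul_sum, ← Finset.sum_add_distrib]
      refine Finset.sum_congr rfl fun i _ => Finset.sum_congr rfl fun j _ => by ring
    rw [e2, ← e1]
    ring
  simp only [map_sum, map_smul, sum_inner, inner_sum, inner_smul_left, inner_smul_right,
    dotProduct, Matrix.mulVec, Finset.mul_sum, symPart, Matrix.of_apply, star_trivial,
    conj_trivial]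
  rw [← e, Finset.sum_comm]
  refine Finset.sum_congr rfl fun i _ => Finset.sum_congr rfl fun j _ => by ring

lemma ConeSubequation.add_smul_one_mem_interior (F : ConeSubequation n) {A : SymMat n}
    (hA : A ∈ F.carrier) {c : ℝ} (hc : 0 < c) : A + c • (1 : SymMat n) ∈ interior F.carrier := by
  rw [mem_interior_iff_mem_nhds]
  set ε := c / (n + 1) with hε
  have hε0 : 0 < ε := by positivity
  have hent : ∀ᶠ B : SymMat n in 𝓝 (A + c • (1 : SymMat n)), ∀ i j,
      |(B - A - c • (1 : SymMat n) : SymMat n).1 i j| < ε := by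
    refine eventually_all.2 fun i => eventually_all.2 fun j => ?_
    have hcont : Continuous fun B : SymMat n =>
        |(B - A - c • (1 : SymMat n) : SymMat n).1 i j| := by
      have h1 : Continuous fun B : SymMat n => B.1 i j :=
        (continuous_apply_apply i j).comp continuous_subtype_val
      exact ((h1.sub continuous_const).sub continuous_const).abs
    refine hcont.continuousAt.eventually_lt continuousAt_const ?_
    simpa using hε0
  filter_upwards [hent] with B hB
  have hpsd : ((B - A : SymMat n) : Matrix (Fin n) (Fin n) ℝ).PosSemidef := by
    refine Matrix.PosSemidef.of_dotProduct_mulVec_nonneg (B - A).2 fun v => ?_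
    have e1 : ((B - A : SymMat n) : Matrix (Fin n) (Fin n) ℝ) =
        (B - A - c • (1 : SymMat n) : SymMat n).1 + c • 1 := by
      simp
    set D := (B - A - c • (1 : SymMat n) : SymMat n).1
    rw [e1, Matrix.add_mulVec, dotProduct_add, Matrix.smul_mulVec, Matrix.one_mulVec,
      dotProduct_smul]
    simp only [dotProduct, star_trivial, Matrix.mulVec, Finset.mul_sum, smul_eq_mul]
    have e2 : -(ε * (∑ i, |v i|) ^ 2) ≤ ∑ i, ∑ j, v i * (D i j * v j) := by
      rw [sq, Finset.sum_mul_sum, Finset.mul_sum, ← Finset.sum_neg_distrib]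
      refine Finset.sum_le_sum fun i _ => ?_
      rw [Finset.mul_sum, ← Finset.sum_neg_distrib]
      refine Finset.sum_le_sum fun j _ => ?_
      have h1 := (hB i j).le
      have h2 : |v i * (D i j * v j)| ≤ ε * (|v i| * |v j|) := by
        rw [abs_mul, abs_mul]
        nlinarith [mul_le_mul_of_nonneg_right h1 (mul_nonneg (abs_nonneg (v i)) (abs_nonneg (v j)))]
      exact (abs_le.1 h2).1
    have e3 : (∑ i, |v i|) ^ 2 ≤ n * ∑ i, v i * v i := by
      have := sq_sum_le_card_mul_sum_sq (s := Finset.univ) (f := fun i => |v i|)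
      simpa [sq] using this
    have e4 : 0 ≤ ∑ i, v i * v i := Finset.sum_nonneg fun i _ => mul_self_nonneg _
    have e5 : ε * n ≤ c := by
      have : ε * (n + 1) = c := by rw [hε]; field_simp
      linarith
    rw [← Finset.mul_sum]
    nlinarith
  simpa using F.f1 A hA (B - A) hpsd

lemma ConeSubequation.not_mem_dualSet_of_neg (F : ConeSubequation n)
    {S T : EucSp n →L[ℝ] EucSp n} (hS : symPart S ∈ F.carrier) {c : ℝ} (hc : 0 < c)
    (h : ∀ v, inner ℝ (S v) v + inner ℝ (T v) v + c * ‖v‖ ^ 2 ≤ 0) :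
    symPart T ∉ dualSet F.carrier := by
  set R : EucSp n →L[ℝ] EucSp n := -(S + T + c • ContinuousLinearMap.id ℝ (EucSp n)) with hR
  have hpsd : (symPart R : Matrix (Fin n) (Fin n) ℝ).PosSemidef := by
    refine symPart_posSemidef fun v => ?_
    have := h v
    simp only [hR, neg_apply, add_apply,
      smul_apply, ContinuousLinearMap.id_apply, inner_neg_left,
      inner_add_left, inner_smul_left, real_inner_self_eq_norm_sq, conj_trivial]
    linarith
  have h1 := F.add_smul_one_mem_interior (F.f1 _ hS _ hpsd) hc
  have h2 : symPart S + symPart R + c • (1 : SymMat n) = -symPart T := by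
    ext i j
    simp only [hR, symPart, AddSubgroup.coe_add, selfAdjoint.val_smul, selfAdjoint.val_one,
      NegMemClass.coe_neg, Matrix.add_apply, Matrix.of_apply, Matrix.smul_apply, Matrix.neg_apply,
      neg_apply, add_apply,
      smul_apply, ContinuousLinearMap.id_apply, inner_neg_left,
      inner_add_left, inner_smul_left, conj_trivial, smul_eq_mul]
    by_cases hij : i = j
    · subst hij; simp; ring
    · have e1 : inner ℝ (EuclideanSpace.single i (1 : ℝ)) (EuclideanSpace.single j 1) =
          (0 : ℝ) := by
        simp [EuclideanSpace.inner_single_left, hij]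
      rw [real_inner_comm (EuclideanSpace.single i 1) (EuclideanSpace.single j 1), e1,
        Matrix.one_apply_ne hij]
      ring
  rw [h2] at h1
  exact fun hT => hT h1

/-- The real-valued truncation `max e (-N)`. -/
def truncBelow (N : ℝ) (e : EReal) : ℝ := (max e ((-N : ℝ) : EReal)).toReal

lemma coe_truncBelow {N : ℝ} {e : EReal} (he : e ≠ ⊤) :
    (truncBelow N e : EReal) = max e ((-N : ℝ) : EReal) := by
  refine EReal.coe_toReal ?_ ?_
  · rcases max_choice e ((-N : ℝ) : EReal) with h | h <;> rw [h]
    exacts [he, EReal.coe_ne_top _]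
  · exact ((EReal.bot_lt_coe _).trans_le (le_max_right _ _)).ne'

lemma le_truncBelow {N : ℝ} {e : EReal} (he : e ≠ ⊤) : e ≤ truncBelow N e := by
  rw [coe_truncBelow he]
  exact le_max_left _ _

lemma truncBelow_le {N B : ℝ} {e : EReal} (he : e ≠ ⊤) (hB : e ≤ B) (hN : -N ≤ B) :
    truncBelow N e ≤ B := by
  rw [← EReal.coe_le_coe_iff, coe_truncBelow he]
  exact max_le hB (EReal.coe_le_coe_iff.2 hN)

lemma truncBelow_eq_or {N : ℝ} {e : EReal} (he : e ≠ ⊤) :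
    truncBelow N e = -N ∨ e = truncBelow N e := by
  rcases max_choice e ((-N : ℝ) : EReal) with h | h
  · exact Or.inr (by rw [coe_truncBelow he, h])
  · exact Or.inl (by rw [truncBelow, h, EReal.toReal_coe])

lemma upperSemicontinuousOn_truncBelow {X : Type*} [TopologicalSpace X] {C : Set X}
    {u : X → EReal} (hu : UpperSemicontinuousOn u C) (htop : ∀ y ∈ C, u y ≠ ⊤) (N : ℝ) :
    UpperSemicontinuousOn (fun y => truncBelow N (u y)) C := by
  intro y hy c hc
  have h1 : max (u y) ((-N : ℝ) : EReal) < c := by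
    rw [← coe_truncBelow (htop y hy)]
    exact EReal.coe_lt_coe_iff.2 hc
  obtain ⟨h2, h3⟩ := max_lt_iff.1 h1
  filter_upwards [hu y hy _ h2, self_mem_nhdsWithin] with t ht htC
  rw [← EReal.coe_lt_coe_iff, coe_truncBelow (htop t htC)]
  exact max_lt ht h3

lemma exists_real_upper_bound {X : Type*} [TopologicalSpace X] {C : Set X} (hC : IsCompact C)
    {u : X → EReal} (hu : UpperSemicontinuousOn u C) (htop : ∀ y ∈ C, u y ≠ ⊤) :
    ∃ B : ℝ, ∀ y ∈ C, u y ≤ B := by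
  rcases C.eq_empty_or_nonempty with rfl | hne
  · exact ⟨0, fun y hy => hy.elim⟩
  · obtain ⟨y₀, hy₀, hmax⟩ := hu.exists_isMaxOn hne hC
    exact ⟨(u y₀).toReal, fun y hy => (hmax hy).trans (EReal.le_coe_toReal (htop y₀ hy₀))⟩

lemma FSubharmonicOn.symPart_mem {S : Set (SymMat n)} {V : Set (EucSp n)} {u : EucSp n → EReal}
    (hu : FSubharmonicOn S V u) {y : EucSp n} (hy : y ∈ V) {c : ℝ} (hc : u y = c) (p : EucSp n)
    (T : EucSp n →L[ℝ] EucSp n)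
    (h : ∀ᶠ k in 𝓝 (0 : EucSp n), y + k ∈ V →
      u (y + k) ≤ ((c + inner ℝ p k + 1 / 2 * inner ℝ (T k) k : ℝ) : EReal)) :
    symPart T ∈ S := by
  set ψ : EucSp n → ℝ :=
    fun t => c + inner ℝ p (t - y) + 1 / 2 * inner ℝ (T (t - y)) (t - y) with hψ
  have hsm : ContDiff ℝ 2 ψ := contDiff_quadratic_s5 y p c T
  have htest : IsTestAt V u ψ y := by
    refine ⟨hsm.contDiffAt, ?_, by simp [hψ, hc]⟩
    have hsub : Tendsto (fun t => t - y) (𝓝 y) (𝓝 (0 : EucSp n)) := by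
      have : Continuous fun t : EucSp n => t - y := by fun_prop
      simpa using this.tendsto y
    filter_upwards [mem_nhdsWithin_of_mem_nhds (hsub.eventually h), self_mem_nhdsWithin]
      with t ht htV
    rw [add_sub_cancel] at ht
    exact ht htV
  obtain ⟨A, hA, hAe⟩ := hu.2.2 y hy ψ htest
  have : A = symPart T := Subtype.ext (by rw [hAe, symPart_val_eq_hessMatrix y p c T])
  exact this ▸ hA

theorem add_nonpos_of_FSubharmonicOn_of_dual (F : ConeSubequation n) {C V : Set (EucSp n)}
    (hC : IsCompact C) (hV : IsOpen V) (hVC : V ⊆ C) {u w : EucSp n → EReal}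
    (hu : UpperSemicontinuousOn u C) (hw : UpperSemicontinuousOn w C)
    (hutop : ∀ y ∈ C, u y ≠ ⊤) (hwtop : ∀ y ∈ C, w y ≠ ⊤)
    (hsu : FSubharmonicOn F.carrier V u) (hsw : FSubharmonicOn (dualSet F.carrier) V w)
    (hb : ∀ y ∈ C \ V, u y + w y ≤ 0) : ∀ y ∈ C, u y + w y ≤ 0 := by
  by_contra! hcon
  obtain ⟨x₀, hx₀, hpos⟩ := hcon
  have hux : u x₀ ≠ ⊥ := fun h => by simp [h] at hpos
  have hwx : w x₀ ≠ ⊥ := fun h => by simp [h] at hpos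
  obtain ⟨r₁, hr₁⟩ : ∃ r : ℝ, u x₀ = r := ⟨_, (EReal.coe_toReal (hutop _ hx₀) hux).symm⟩
  obtain ⟨r₂, hr₂⟩ : ∃ r : ℝ, w x₀ = r := ⟨_, (EReal.coe_toReal (hwtop _ hx₀) hwx).symm⟩
  have hr : 0 < r₁ + r₂ := by
    rw [hr₁, hr₂] at hpos
    exact_mod_cast hpos
  obtain ⟨Bu, hBu⟩ := exists_real_upper_bound hC hu hutop
  obtain ⟨Bw, hBw⟩ := exists_real_upper_bound hC hw hwtop
  obtain ⟨R, hR⟩ := hC.isBounded.exists_norm_le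
  set N := |Bu| + |Bw| with hN
  have hNu : Bu ≤ N ∧ -N ≤ Bu ∧ -Bu ≥ -N := by
    refine ⟨?_, ?_, ?_⟩ <;>
      linarith [le_abs_self Bu, neg_abs_le Bu, abs_nonneg Bw]
  have hNw : Bw ≤ N ∧ -N ≤ Bw ∧ -Bw ≥ -N := by
    refine ⟨?_, ?_, ?_⟩ <;>
      linarith [le_abs_self Bw, neg_abs_le Bw, abs_nonneg Bu]
  set η := (r₁ + r₂) / (2 * (R ^ 2 + 1)) with hη
  have hη0 : 0 < η := by positivity
  have hηR : η * R ^ 2 < r₁ + r₂ := by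
    have : η * (2 * (R ^ 2 + 1)) = r₁ + r₂ := by rw [hη]; field_simp
    nlinarith [sq_nonneg R]
  have hnorm : ∀ y ∈ C, ‖y‖ ^ 2 ≤ R ^ 2 := fun y hy =>
    pow_le_pow_left₀ (norm_nonneg y) (hR y hy) 2
  set U : EucSp n → ℝ := fun y => truncBelow N (u y) with hU
  set W₀ : EucSp n → ℝ := fun y => truncBelow N (w y) with hW₀
  have hUB : ∀ y ∈ C, U y ≤ Bu := fun y hy => truncBelow_le (hutop y hy) (hBu y hy) hNu.2.1
  have hWB : ∀ y ∈ C, W₀ y ≤ Bw := fun y hy => truncBelow_le (hwtop y hy) (hBw y hy) hNw.2.1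
  have hWusc : UpperSemicontinuousOn (fun y => W₀ y + η * ‖y‖ ^ 2) C :=
    (upperSemicontinuousOn_truncBelow hw hwtop N).add
      ((by fun_prop : Continuous fun y : EucSp n => η * ‖y‖ ^ 2).upperSemicontinuous.upperSemicontinuousOn C)
  have hm : ∀ y ∈ C \ V, U y + (W₀ y + η * ‖y‖ ^ 2) ≤ η * R ^ 2 := by
    intro y hy
    have h1 : U y + W₀ y ≤ 0 := by
      rcases truncBelow_eq_or (N := N) (hutop y hy.1) with h | h
      · have h2 := hWB y hy.1
        have h3 : U y = -N := h
        linarith [hNw.1]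
      · rcases truncBelow_eq_or (N := N) (hwtop y hy.1) with h' | h'
        · have h2 := hUB y hy.1
          have h3 : W₀ y = -N := h'
          linarith [hNu.1]
        · have h2 := hb y hy
          rw [h, h'] at h2
          exact_mod_cast h2
    have h2 := mul_le_mul_of_nonneg_left (hnorm y hy.1) hη0.le
    linarith
  have hM : r₁ + r₂ ≤ U x₀ + (W₀ x₀ + η * ‖x₀‖ ^ 2) := by
    have h1 : r₁ ≤ U x₀ := by
      have := le_truncBelow (N := N) (hutop x₀ hx₀)
      rw [hr₁] at this
      simpa [hU, hr₁] using this
    have h2 : r₂ ≤ W₀ x₀ := by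
      have := le_truncBelow (N := N) (hwtop x₀ hx₀)
      rw [hr₂] at this
      simpa [hW₀, hr₂] using this
    have : 0 ≤ η * ‖x₀‖ ^ 2 := by positivity
    linarith
  obtain ⟨y, hy, z, hz, hyC, hzC, hgt, p, q, A, B, htu, htw, hAB⟩ :=
    exists_quadratic_tests_of_interior_max hC hV
      (upperSemicontinuousOn_truncBelow hu hutop N) hWusc hηR hm hx₀ hM
      (by positivity : 0 < η / 4)
  have hz2 := mul_le_mul_of_nonneg_left (hnorm z hzC) hη0.le
  have hzW := hWB z hzC
  have hyU := hUB y hyC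
  have huy : u y = U y := by
    refine (truncBelow_eq_or (hutop y hyC)).resolve_left fun h => ?_
    linarith [hNw.2.2]
  have hwz : w z = W₀ z := by
    refine (truncBelow_eq_or (hwtop z hzC)).resolve_left fun h => ?_
    have h' : W₀ z = -N := h
    have hgt' : η * R ^ 2 < U y + (W₀ z + η * ‖z‖ ^ 2) := hgt
    linarith [hNu.2.2]
  have hS := hsu.symPart_mem hy huy p (A + (η / 2) • ContinuousLinearMap.id ℝ (EucSp n)) (by
    filter_upwards [htu] with k hk hkV
    refine (le_truncBelow (N := N) (hutop _ (hVC hkV))).trans (EReal.coe_le_coe_iff.2 ?_)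
    refine (hk (hVC hkV)).trans (le_of_eq ?_)
    simp [inner_add_left, inner_smul_left]
    ring)
  have hT := hsw.symPart_mem hz hwz (q - (2 * η) • z)
    (B - (3 * η / 2) • ContinuousLinearMap.id ℝ (EucSp n)) (by
    filter_upwards [htw] with k hk hkV
    refine (le_truncBelow (N := N) (hwtop _ (hVC hkV))).trans (EReal.coe_le_coe_iff.2 ?_)
    have h1 := hk (hVC hkV)
    rw [norm_add_sq_real] at h1
    simp [inner_sub_left, inner_smul_left]
    change W₀ (z + k) ≤ _
    linarith)
  refine F.not_mem_dualSet_of_neg hS hη0 (fun v => ?_) hT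
  have := hAB v
  simp [inner_add_left, inner_sub_left, inner_smul_left]
  linarith

end Comparison

section PolarSingularities

lemma EReal.coe_mul_add_coe_le_coe_iff {a b r : ℝ} (ha : 0 < a) (e : EReal) :
    (a : EReal) * e + (b : EReal) ≤ (r : EReal) ↔ e ≤ ((a⁻¹ * (r - b) : ℝ) : EReal) := by
  induction e with
  | bot => simp [EReal.coe_mul_bot_of_pos ha]
  | top => simpa [EReal.coe_mul_top_of_pos ha] using EReal.coe_ne_top (a⁻¹ * (r - b))
  | coe e =>
    norm_cast
    rw [inv_mul_eq_div, le_div_iff₀ ha, mul_comm e a]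
    exact _root_.le_sub_iff_add_le.symm

lemma EReal.coe_mul_add_coe_eq_coe_iff {a b r : ℝ} (ha : 0 < a) (e : EReal) :
    (a : EReal) * e + (b : EReal) = (r : EReal) ↔ e = ((a⁻¹ * (r - b) : ℝ) : EReal) := by
  induction e with
  | bot => simpa [EReal.coe_mul_bot_of_pos ha] using (EReal.coe_ne_bot (a⁻¹ * (r - b))).symm
  | top => simpa [EReal.coe_mul_top_of_pos ha] using (EReal.coe_ne_top (a⁻¹ * (r - b))).symm
  | coe e =>
    norm_cast
    rw [inv_mul_eq_div, eq_div_iff ha.ne', mul_comm e a, eq_sub_iff_add_eq]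

lemma EReal.coe_mul_add_coe_ne_top {a b : ℝ} (ha : 0 < a) {e : EReal} (he : e ≠ ⊤) :
    (a : EReal) * e + (b : EReal) ≠ ⊤ := by
  induction e with
  | bot => simp [EReal.coe_mul_bot_of_pos ha]
  | top => exact absurd rfl he
  | coe e => norm_cast; exact EReal.coe_ne_top _

lemma UpperSemicontinuousOn.ereal_coe_mul_add_coe {X : Type*} [TopologicalSpace X] {C : Set X}
    {v : X → EReal} (hv : UpperSemicontinuousOn v C) {a : ℝ} (ha : 0 < a) (b : ℝ) :
    UpperSemicontinuousOn (fun y => (a : EReal) * v y + (b : EReal)) C := by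
  intro y hy c hc
  obtain ⟨r, hr, hrc⟩ := EReal.lt_iff_exists_real_btwn.1 hc
  have h1 : v y < ((a⁻¹ * (r - b) : ℝ) : EReal) :=
    lt_of_le_of_ne ((EReal.coe_mul_add_coe_le_coe_iff ha _).1 hr.le)
      fun h => hr.ne ((EReal.coe_mul_add_coe_eq_coe_iff ha _).2 h)
  filter_upwards [hv y hy _ h1] with t ht
  exact ((EReal.coe_mul_add_coe_le_coe_iff ha _).2 ht.le).trans_lt hrc

lemma hessMatrix_const_mul_sub (ψ : EucSp n → ℝ) (a b : ℝ) (y : EucSp n) :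
    hessMatrix (fun t => a * (ψ t - b)) y = a • hessMatrix ψ y := by
  have h1 : fderiv ℝ (fun t => a * (ψ t - b)) = fun t => a • fderiv ℝ ψ t := by
    funext t
    have := congrFun (fderiv_const_smul_field (𝕜 := ℝ) (f := fun t => ψ t - b) a) t
    simpa [Pi.smul_def, fderiv_sub_const] using this
  have h2 : fderiv ℝ (fun t => a • fderiv ℝ ψ t) y = a • fderiv ℝ (fderiv ℝ ψ) y :=
    congrFun (fderiv_const_smul_field (𝕜 := ℝ) (f := fderiv ℝ ψ) a) y
  ext i j
  simp [hessMatrix, iteratedFDeriv_two_apply, h1, h2]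

lemma FSubharmonicOn.mono_of_isOpen {S : Set (SymMat n)} {X V : Set (EucSp n)}
    {u : EucSp n → EReal} (hu : FSubharmonicOn S X u) (hV : IsOpen V) (hVX : V ⊆ X) :
    FSubharmonicOn S V u := by
  refine ⟨fun y hy => (hu.1.mono hVX) y hy, fun y hy => hu.2.1 y (hVX hy), ?_⟩
  rintro y hy ψ ⟨h1, h2, h3⟩
  refine hu.2.2 y (hVX hy) ψ ⟨h1, ?_, h3⟩
  rw [hV.nhdsWithin_eq hy] at h2
  exact h2.filter_mono nhdsWithin_le_nhds

lemma FSubharmonicOn.coe_mul_add_coe {F : ConeSubequation n} {X : Set (EucSp n)}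
    {v : EucSp n → EReal} (hv : FSubharmonicOn F.carrier X v) {a : ℝ} (ha : 0 < a) (b : ℝ) :
    FSubharmonicOn F.carrier X fun y => (a : EReal) * v y + (b : EReal) := by
  refine ⟨hv.1.ereal_coe_mul_add_coe ha b,
    fun y hy => EReal.coe_mul_add_coe_ne_top ha (hv.2.1 y hy), ?_⟩
  rintro y hy ψ ⟨h1, h2, h3⟩
  obtain ⟨A, hA, hAe⟩ := hv.2.2 y hy (fun t => a⁻¹ * (ψ t - b))
    ⟨contDiffAt_const.mul (h1.sub contDiffAt_const),
      h2.mono fun t ht => (EReal.coe_mul_add_coe_le_coe_iff ha _).1 ht,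
      (EReal.coe_mul_add_coe_eq_coe_iff ha _).1 h3⟩
  refine ⟨a • A, F.f2 A hA a ha, ?_⟩
  rw [selfAdjoint.val_smul, hAe, hessMatrix_const_mul_sub, smul_smul, mul_inv_cancel₀ ha.ne',
    one_smul]

lemma DPSingular.eventually_perturbation_nonpos {F : ConeSubequation n} {U : Set (EucSp n)}
    {x₀ : EucSp n} {h v w : EucSp n → EReal} (hh : DPSingular F U x₀ h) (hpolar : h x₀ = ⊥)
    {c k : ℝ} (hv : ∀ᶠ y in 𝓝[≠] x₀, v y ≤ h y + (c : EReal))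
    (hw : ∀ᶠ y in 𝓝[≠] x₀, w y ≤ -(h y) + (k : EReal)) {δ : ℝ} (hδ : 0 < δ) (b : ℝ) :
    ∀ᶠ y in 𝓝[≠] x₀, ((1 + δ : ℝ) : EReal) * v y + (b : EReal) + w y ≤ 0 := by
  set r := -((1 + δ) * c + b + k) / δ with hr
  have hU : U ∈ 𝓝 x₀ := hh.isOpen'.mem_nhds hh.mem
  have hlt : ∀ᶠ y in 𝓝 x₀, h y < r :=
    (hh.cont.continuousAt hU).eventually_lt continuousAt_const
      (by rw [hpolar]; exact EReal.bot_lt_coe r)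
  filter_upwards [hv, hw, mem_nhdsWithin_of_mem_nhds hlt, mem_nhdsWithin_of_mem_nhds hU,
    self_mem_nhdsWithin] with y hvy hwy hlty hyU hne
  have hbot : h y ≠ ⊥ := (bot_le.trans_lt (hh.strictMin y hyU hne)).ne'
  lift h y to ℝ using ⟨hlty.ne_top, hbot⟩ with s
  have hsr : δ * s + ((1 + δ) * c + b + k) ≤ 0 := by
    have h1 : s < r := EReal.coe_lt_coe_iff.1 hlty
    rw [hr, lt_div_iff₀ hδ] at h1
    linarith
  have h1 : ((1 + δ : ℝ) : EReal) * v y + (b : EReal) ≤ (((1 + δ) * (s + c) + b : ℝ) : EReal) := by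
    rw [EReal.coe_mul_add_coe_le_coe_iff (by positivity), add_sub_cancel_right,
      inv_mul_cancel_left₀ (by positivity)]
    exact_mod_cast hvy
  have h2 : w y ≤ ((-s + k : ℝ) : EReal) := by exact_mod_cast hwy
  refine (add_le_add h1 h2).trans ?_
  rw [← EReal.coe_add, ← EReal.coe_zero, EReal.coe_le_coe_iff]
  linarith

lemma perturbation_add_nonpos {v w : EReal} (hv : v ≠ ⊤) (hw : w ≠ ⊤) {B δ : ℝ} (hδ : 0 < δ)
    (hB : v ≤ B) (h : v + w ≤ 0) :
    ((1 + δ : ℝ) : EReal) * v + ((-(δ * B) : ℝ) : EReal) + w ≤ 0 := by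
  induction w with
  | bot => simp
  | top => exact absurd rfl hw
  | coe w =>
    induction v with
    | bot => rw [EReal.coe_mul_bot_of_pos (by positivity)]; simp
    | top => exact absurd rfl hv
    | coe v =>
      norm_cast at *
      nlinarith

end PolarSingularities

/-- Comparison in the polar case, Theorem 5.2. -/
theorem dirichlet_singularities_stmt5 {n k : ℕ} (F : ConeSubequation n)
    (Ω : Set (EucSp n)) (hΩ : IsBoundedDomain Ω)
    (x : Fin k → EucSp n) (hx : ∀ j, x j ∈ Ω)
    (U : Fin k → Set (EucSp n)) (h : Fin k → EucSp n → EReal)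
    (hh : ∀ j, DPSingular F (U j) (x j) (h j)) (hpolar : ∀ j, h j (x j) = ⊥)
    (v w : EucSp n → EReal)
    (hvusc : UpperSemicontinuousOn v (closure Ω \ Set.range x))
    (hwusc : UpperSemicontinuousOn w (closure Ω \ Set.range x))
    (hvtop : ∀ y ∈ closure Ω \ Set.range x, v y ≠ ⊤)
    (hwtop : ∀ y ∈ closure Ω \ Set.range x, w y ≠ ⊤)
    (hv : FSubharmonicOn F.carrier (Ω \ Set.range x) v)
    (hw : FSubharmonicOn (dualSet F.carrier) (Ω \ Set.range x) w)
    (cs ks : Fin k → ℝ)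
    (hvb : ∀ j, ∀ᶠ y in 𝓝[≠] x j, v y ≤ h j y + (cs j : EReal))
    (hwb : ∀ j, ∀ᶠ y in 𝓝[≠] x j, w y ≤ -(h j y) + (ks j : EReal))
    (hbdry : ∀ y ∈ frontier Ω, v y + w y ≤ 0) :
    ∀ y ∈ Ω \ Set.range x, v y + w y ≤ 0 := by
  have hΩo := hΩ.1
  have hcomp : IsCompact (closure Ω) := hΩ.2.2.isCompact_closure
  have hfr : frontier Ω ⊆ closure Ω \ Set.range x := by
    refine fun y hy => ⟨frontier_subset_closure hy, ?_⟩
    rintro ⟨j, rfl⟩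
    exact (hΩo.frontier_eq ▸ hy).2 (hx j)
  obtain ⟨B, hB⟩ := exists_real_upper_bound (hcomp.of_isClosed_subset isClosed_frontier
    frontier_subset_closure) (hvusc.mono hfr) fun y hy => hvtop y (hfr hy)
  have key : ∀ δ : ℝ, 0 < δ → ∀ y ∈ Ω \ Set.range x,
      ((1 + δ : ℝ) : EReal) * v y + ((-(δ * B) : ℝ) : EReal) + w y ≤ 0 := by
    intro δ hδ
    have hδ1 : 0 < 1 + δ := by positivity
    have hball : ∀ j, ∃ r : ℝ, 0 < r ∧ ∀ y ∈ Metric.closedBall (x j) r, y ≠ x j →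
        ((1 + δ : ℝ) : EReal) * v y + ((-(δ * B) : ℝ) : EReal) + w y ≤ 0 := by
      intro j
      have h1 := (hh j).eventually_perturbation_nonpos (hpolar j) (hvb j) (hwb j) hδ (-(δ * B))
      rw [eventually_nhdsWithin_iff, Metric.nhds_basis_closedBall.eventually_iff] at h1
      obtain ⟨r, hr, hy⟩ := h1
      exact ⟨r, hr, fun y hyr hne => hy hyr hne⟩
    choose r hr hrb using hball
    set C := closure Ω \ ⋃ j, Metric.ball (x j) (r j) with hCdef
    set V := Ω \ ⋃ j, Metric.closedBall (x j) (r j) with hVdef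
    have hC : IsCompact C := hcomp.diff (isOpen_iUnion fun j => Metric.isOpen_ball)
    have hV : IsOpen V := hΩo.sdiff (isClosed_iUnion_of_finite fun j => Metric.isClosed_closedBall)
    have hVC : V ⊆ C := fun y hy => ⟨subset_closure hy.1, fun h => hy.2
      (Set.iUnion_mono (fun j => Metric.ball_subset_closedBall) h)⟩
    have hCX : C ⊆ closure Ω \ Set.range x := by
      refine fun y hy => ⟨hy.1, ?_⟩
      rintro ⟨j, rfl⟩
      exact hy.2 (Set.mem_iUnion.2 ⟨j, Metric.mem_ball_self (hr j)⟩)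
    have hVX : V ⊆ Ω \ Set.range x := fun y hy => ⟨hy.1, (hCX (hVC hy)).2⟩
    have hCb := add_nonpos_of_FSubharmonicOn_of_dual F hC hV hVC
      ((hvusc.mono hCX).ereal_coe_mul_add_coe hδ1 (-(δ * B))) (hwusc.mono hCX)
      (fun y hy => EReal.coe_mul_add_coe_ne_top hδ1 (hvtop y (hCX hy)))
      (fun y hy => hwtop y (hCX hy))
      ((hv.mono_of_isOpen hV hVX).coe_mul_add_coe hδ1 (-(δ * B))) (hw.mono_of_isOpen hV hVX) (by
        intro y hy
        by_cases hyΩ : y ∈ Ω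
        · have h1 : y ∈ ⋃ j, Metric.closedBall (x j) (r j) := by
            by_contra h1
            exact hy.2 ⟨hyΩ, h1⟩
          obtain ⟨j, hj⟩ := Set.mem_iUnion.1 h1
          exact hrb j y hj fun h => (hCX hy.1).2 ⟨j, h.symm⟩
        · have h1 : y ∈ frontier Ω := hΩo.frontier_eq ▸ ⟨hy.1.1, hyΩ⟩
          exact perturbation_add_nonpos (hvtop y (hfr h1)) (hwtop y (hfr h1)) hδ (hB y h1)
            (hbdry y h1))
    intro y hy
    by_cases h1 : y ∈ ⋃ j, Metric.ball (x j) (r j)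
    · obtain ⟨j, hj⟩ := Set.mem_iUnion.1 h1
      exact hrb j y (Metric.ball_subset_closedBall hj) fun h => hy.2 ⟨j, h.symm⟩
    · exact hCb y ⟨subset_closure hy.1, h1⟩
  intro y hy
  have hyC : y ∈ closure Ω \ Set.range x := ⟨subset_closure hy.1, hy.2⟩
  by_contra! hpos
  have hv0 : v y ≠ ⊥ := fun h => by simp [h] at hpos
  have hw0 : w y ≠ ⊥ := fun h => by simp [h] at hpos
  have hkey := fun δ hδ => key δ hδ y hy
  lift v y to ℝ using ⟨hvtop y hyC, hv0⟩ with a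
  lift w y to ℝ using ⟨hwtop y hyC, hw0⟩ with b
  norm_cast at hpos hkey
  have h1 := hkey ((a + b) / (2 * (|a - B| + 1))) (by positivity)
  set δ := (a + b) / (2 * (|a - B| + 1)) with hδ
  have h2 : δ * (2 * (|a - B| + 1)) = a + b := by rw [hδ]; field_simp
  have hδ0 : 0 < δ := by positivity
  nlinarith [mul_le_mul_of_nonneg_left (neg_abs_le (a - B)) hδ0.le,
    mul_nonneg hδ0.le (abs_nonneg (a - B))]
end
end
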